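/- arXiv:2302.00611 — 3 statements merged into one kernel-verified Lean document; each statement's English description precedes it below -/
import Mathlib

section
/- Let E be a finite-dimensional real inner product space, E₀ ⊆ E a subspace, Q a symmetric bilinear form on E₀, τ > 0, and t ↦ R_t a continuous family of self-adjoint operators on E. Then the interval [0,τ] contains no focal points for the operator J = d²/dt² + R_t and boundary condition (E₀, Q) if and only if I(u) > 0 for every curve u ∈ Ω([0,τ],E) with u not identically zero. -/
open scoped RealInnerProductSpace

variable {E : Type*} [NormedAddCommGroup E] [InnerProductSpace ℝ E]

/-- `f : ℝ → E` is continuous on `[a,b]` and piecewise `C^n` there, i.e. there is a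
finite partition `a = s₀ < s₁ < ⋯ < s_k = b` such that `f` is `C^n` on each closed
subinterval `[sᵢ, sᵢ₊₁]` (derivatives being taken one-sidedly at the endpoints). -/
def PiecewiseContDiffOn (n : ℕ) (f : ℝ → E) (a b : ℝ) : Prop :=
  ContinuousOn f (Set.Icc a b) ∧
  ∃ (k : ℕ) (s : Fin (k + 1) → ℝ), StrictMono s ∧ s 0 = a ∧ s (Fin.last k) = b ∧
    ∀ i : Fin k, ContDiffOn ℝ (n : ℕ∞) f (Set.Icc (s i.castSucc) (s i.succ))

/-- Membership in the space `Ω([0,τ],E)` of continuous piecewise `C²` curves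
`v : [0,τ] → E` with `v 0 ∈ E₀`, `⟪v' 0, w⟫ = -Q (v 0) w` for all `w ∈ E₀`, and `v τ = 0`. -/
def InOmega (E₀ : Submodule ℝ E) (Q : E →ₗ[ℝ] E →ₗ[ℝ] ℝ) (τ : ℝ) (v : ℝ → E) : Prop :=
  PiecewiseContDiffOn 2 v 0 τ ∧ v 0 ∈ E₀ ∧
  (∀ w ∈ E₀, ⟪derivWithin v (Set.Icc 0 τ) 0, w⟫ = -(Q (v 0) w)) ∧
  v τ = 0

/-- The index form `I(v) = -Q(v 0, v 0) + ∫₀^τ (⟪v', v'⟫ - ⟪R_t (v t), v t⟫) dt`. -/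
noncomputable def indexForm (R : ℝ → E →L[ℝ] E) (Q : E →ₗ[ℝ] E →ₗ[ℝ] ℝ) (τ : ℝ)
    (v : ℝ → E) : ℝ :=
  -(Q (v 0) (v 0)) + ∫ t in (0:ℝ)..τ,
    (⟪derivWithin v (Set.Icc 0 τ) t, derivWithin v (Set.Icc 0 τ) t⟫ - ⟪R t (v t), v t⟫)

/-- A `C²` curve `u : [0,a] → E` with `u'' + R_t u = 0` on `[0,a]`, `u 0 ∈ E₀`,
`⟪u' 0, w⟫ = -Q (u 0) w` for all `w ∈ E₀`, and `u a = 0`. -/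
def IsFocalSolution (R : ℝ → E →L[ℝ] E) (E₀ : Submodule ℝ E) (Q : E →ₗ[ℝ] E →ₗ[ℝ] ℝ)
    (a : ℝ) (u : ℝ → E) : Prop :=
  ContDiffOn ℝ 2 u (Set.Icc 0 a) ∧
  (∀ t ∈ Set.Icc 0 a,
    derivWithin (derivWithin u (Set.Icc 0 a)) (Set.Icc 0 a) t + R t (u t) = 0) ∧
  u 0 ∈ E₀ ∧
  (∀ w ∈ E₀, ⟪derivWithin u (Set.Icc 0 a) 0, w⟫ = -(Q (u 0) w)) ∧
  u a = 0

/-- `a ∈ (0,τ]` is a focal point for `J = d²/dt² + R_t` and boundary condition `(E₀, Q)`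
if there is a nontrivial solution on `[0,a]`. -/
def IsFocalPoint (R : ℝ → E →L[ℝ] E) (E₀ : Submodule ℝ E) (Q : E →ₗ[ℝ] E →ₗ[ℝ] ℝ)
    (τ a : ℝ) : Prop :=
  a ∈ Set.Ioc 0 τ ∧
  ∃ u : ℝ → E, IsFocalSolution R E₀ Q a u ∧ ∃ t ∈ Set.Icc 0 a, u t ≠ 0

/-- The multiplicity of a focal point: the maximal number of focal solutions on `[0,a]`
that are linearly independent as curves on `[0,a]`. -/
noncomputable def focalMultiplicity (R : ℝ → E →L[ℝ] E) (E₀ : Submodule ℝ E)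
    (Q : E →ₗ[ℝ] E →ₗ[ℝ] ℝ) (a : ℝ) : ℕ :=
  sSup {n : ℕ | ∃ u : Fin n → ℝ → E,
    (∀ i, IsFocalSolution R E₀ Q a (u i)) ∧
    ∀ c : Fin n → ℝ, (∀ t ∈ Set.Icc 0 a, (∑ i, c i • u i t) = 0) → c = 0}

/-- The set of `n` such that there are `n` elements of `Ω([0,τ],E)`, linearly independent
as curves on `[0,τ]`, on (the span of) which the index form is negative.  The Morse index
of the index form is the supremum of this set. -/
def MorseIndexSet (R : ℝ → E →L[ℝ] E) (E₀ : Submodule ℝ E) (Q : E →ₗ[ℝ] E →ₗ[ℝ] ℝ)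
    (τ : ℝ) : Set ℕ :=
  {n | ∃ v : Fin n → ℝ → E,
    (∀ i, InOmega E₀ Q τ (v i)) ∧
    (∀ c : Fin n → ℝ, (∀ t ∈ Set.Icc 0 τ, (∑ i, c i • v i t) = 0) → c = 0) ∧
    (∀ c : Fin n → ℝ, c ≠ 0 → indexForm R Q τ (fun t => ∑ i, c i • v i t) < 0)}

/-- `J = d²/dt² + R_t` is disconjugate on a set `s ⊆ ℝ`: no nontrivial `C²` solution of
`u'' + R_t u = 0` on `s` vanishes at two distinct points of `s`. -/
def DisconjugateOn (R : ℝ → E →L[ℝ] E) (s : Set ℝ) : Prop :=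
  ∀ u : ℝ → E, ContDiffOn ℝ 2 u s →
    (∀ t ∈ s, derivWithin (derivWithin u s) s t + R t (u t) = 0) →
    ∀ s₁ ∈ s, ∀ s₂ ∈ s, s₁ ≠ s₂ → u s₁ = 0 → u s₂ = 0 → ∀ t ∈ s, u t = 0

/-- `a < b` are mutually conjugate if there is a not-identically-zero `C²` solution of
`v'' + R_t v = 0` on `[a,b]` with `v a = v b = 0`. -/
def MutuallyConjugate (R : ℝ → E →L[ℝ] E) (a b : ℝ) : Prop :=
  a < b ∧ ∃ v : ℝ → E, ContDiffOn ℝ 2 v (Set.Icc a b) ∧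
    (∀ t ∈ Set.Icc a b,
      derivWithin (derivWithin v (Set.Icc a b)) (Set.Icc a b) t + R t (v t) = 0) ∧
    v a = 0 ∧ v b = 0 ∧ ∃ t ∈ Set.Icc a b, v t ≠ 0


open Set Filter Topology MeasureTheory

section ODE

/-- radial retraction -/
noncomputable def radRetr {X : Type*} [NormedAddCommGroup X] [NormedSpace ℝ X] (ρ : ℝ) (x : X) : X :=
  (ρ / max ρ ‖x‖) • x

lemma radRetr_of_le {X : Type*} [NormedAddCommGroup X] [NormedSpace ℝ X] {ρ : ℝ} (hρ : 0 < ρ)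
    {x : X} (hx : ‖x‖ ≤ ρ) : radRetr ρ x = x := by
  rw [radRetr, max_eq_left hx, div_self hρ.ne', one_smul]

lemma radRetr_norm_le {X : Type*} [NormedAddCommGroup X] [NormedSpace ℝ X] {ρ : ℝ} (hρ : 0 < ρ)
    (x : X) : ‖radRetr ρ x‖ ≤ ρ := by
  have hm : 0 < max ρ ‖x‖ := lt_max_of_lt_left hρ
  rw [radRetr, norm_smul, Real.norm_of_nonneg (by positivity), div_mul_eq_mul_div, div_le_iff₀ hm]
  gcongr
  exact le_max_right _ _

lemma radRetr_norm_le' {X : Type*} [NormedAddCommGroup X] [NormedSpace ℝ X] {ρ : ℝ} (hρ : 0 < ρ)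
    (x : X) : ‖radRetr ρ x‖ ≤ ‖x‖ := by
  have hm : 0 < max ρ ‖x‖ := lt_max_of_lt_left hρ
  rw [radRetr, norm_smul, Real.norm_of_nonneg (by positivity), div_mul_eq_mul_div, div_le_iff₀ hm,
    mul_comm]
  gcongr
  exact le_max_left _ _

lemma radRetr_lip {X : Type*} [NormedAddCommGroup X] [NormedSpace ℝ X] {ρ : ℝ} (hρ : 0 < ρ)
    (x y : X) : ‖radRetr ρ x - radRetr ρ y‖ ≤ 2 * ‖x - y‖ := by
  unfold radRetr
  set m := max ρ ‖x‖ with hm'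
  set n := max ρ ‖y‖ with hn'
  have hm : 0 < m := lt_max_of_lt_left hρ
  have hn : 0 < n := lt_max_of_lt_left hρ
  have hρm : ρ ≤ m := le_max_left _ _
  have hyn : ‖y‖ ≤ n := le_max_right _ _
  have h1 : (ρ / m) • x - (ρ / n) • y = (ρ / m) • (x - y) + (ρ * (n - m) / (m * n)) • y := by
    have : ρ / n = ρ / m - ρ * (n - m) / (m * n) := by field_simp; ring
    rw [this]; module
  have h2 : |n - m| ≤ ‖x - y‖ := by
    calc |n - m| ≤ |‖y‖ - ‖x‖| := by
          simpa [hm', hn'] using abs_max_sub_max_le_max ρ ‖y‖ ρ ‖x‖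
      _ ≤ ‖y - x‖ := abs_norm_sub_norm_le y x
      _ = _ := norm_sub_rev _ _
  have h3 : ‖(ρ / m) • (x - y)‖ ≤ ‖x - y‖ := by
    rw [norm_smul, Real.norm_of_nonneg (by positivity)]
    exact mul_le_of_le_one_left (norm_nonneg _) ((div_le_one hm).2 hρm)
  have h4 : ‖(ρ * (n - m) / (m * n)) • y‖ ≤ ‖x - y‖ := by
    rw [norm_smul, Real.norm_eq_abs, abs_div, abs_mul, abs_of_pos hρ, abs_of_pos (mul_pos hm hn),
      div_mul_eq_mul_div, div_le_iff₀ (mul_pos hm hn)]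
    calc ρ * |n - m| * ‖y‖ ≤ m * ‖x - y‖ * n := by gcongr
      _ = _ := by ring
  rw [h1]
  linarith [norm_add_le ((ρ / m) • (x - y)) ((ρ * (n - m) / (m * n)) • y)]

/-- global existence for linear ODE -/
lemma exists_linear_ode {X : Type*} [NormedAddCommGroup X] [NormedSpace ℝ X] [CompleteSpace X]
    (τ : ℝ) (hτ : 0 < τ) (F : ℝ → X →L[ℝ] X) (hF : ContinuousOn F (Icc 0 τ)) (x₀ : X) :
    ∃ α : ℝ → X, α 0 = x₀ ∧ ∀ t ∈ Icc 0 τ, HasDerivWithinAt α (F t (α t)) (Icc 0 τ) t := by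
  obtain ⟨K, hK⟩ := isCompact_Icc.exists_bound_of_continuousOn hF
  have hK0 : 0 ≤ K := (norm_nonneg _).trans (hK 0 ⟨le_rfl, hτ.le⟩)
  set ρ : ℝ := (‖x₀‖ + 1) * Real.exp (K * τ) with hρd
  have hρ : 0 < ρ := by positivity
  let f : ℝ → X → X := fun t x => F t (radRetr ρ x)
  have hPL : IsPicardLindelof f (tmin := 0) (tmax := τ) ⟨0, le_rfl, hτ.le⟩ x₀
      (Real.toNNReal (K * ρ * τ)) 0 (Real.toNNReal (K * ρ)) (Real.toNNReal (2 * K)) := by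
    refine ⟨?_, ?_, ?_, ?_⟩
    · intro t ht
      apply LipschitzWith.lipschitzOnWith
      apply LipschitzWith.of_dist_le_mul
      intro x y
      rw [dist_eq_norm, dist_eq_norm, Real.coe_toNNReal _ (by positivity)]
      simp only [f]
      rw [← map_sub]
      calc _ ≤ ‖F t‖ * ‖radRetr ρ x - radRetr ρ y‖ := (F t).le_opNorm _
        _ ≤ K * (2 * ‖x - y‖) := by
          gcongr
          · exact hK t ht
          · exact radRetr_lip hρ x y
        _ = _ := by ring
    · intro x _
      exact hF.clm_apply continuousOn_const
    · intro t ht x _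
      rw [Real.coe_toNNReal _ (by positivity)]
      calc _ ≤ ‖F t‖ * ‖radRetr ρ x‖ := (F t).le_opNorm _
        _ ≤ K * ρ := by
          gcongr
          · exact hK t ht
          · exact radRetr_norm_le hρ x
    · rw [Real.coe_toNNReal _ (by positivity), Real.coe_toNNReal _ (by positivity)]
      simp [hτ.le]
  obtain ⟨α, hα0, hα⟩ := hPL.exists_eq_forall_mem_Icc_hasDerivWithinAt₀
  refine ⟨α, hα0, ?_⟩
  have hb := norm_le_gronwallBound_of_norm_deriv_right_le (f := α) (f' := fun t => f t (α t))
    (δ := ‖x₀‖) (K := K) (ε := 0) (a := 0) (b := τ)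
    (fun t ht => (hα t ht).continuousWithinAt)
    (fun t ht => (hα t ⟨ht.1, ht.2.le⟩).mono_of_mem_nhdsWithin
      (mem_of_superset (Icc_mem_nhdsGE ht.2) (Icc_subset_Icc_left ht.1)))
    (by rw [hα0]) (fun t ht => by
      rw [add_zero]
      calc _ ≤ ‖F t‖ * ‖radRetr ρ (α t)‖ := (F t).le_opNorm _
        _ ≤ _ := by
          gcongr
          · exact hK t ⟨ht.1, ht.2.le⟩
          · exact radRetr_norm_le' hρ _)
  intro t ht
  have h1 : ‖α t‖ ≤ ρ := by
    have := hb t ht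
    rw [gronwallBound_ε0, sub_zero] at this
    refine this.trans ?_
    rw [hρd]
    gcongr
    · linarith
    · exact ht.2
  have := hα t ht
  simp only [f] at this
  rwa [radRetr_of_le hρ h1] at this

end ODE

section Frame

lemma exists_riesz [FiniteDimensional ℝ E] (Q : E →ₗ[ℝ] E →ₗ[ℝ] ℝ) :
    ∃ q : E →L[ℝ] E, ∀ x w, ⟪q x, w⟫ = Q x w := by
  have : CompleteSpace E := FiniteDimensional.complete ℝ E
  let q' : E →ₗ[ℝ] E :=
    { toFun := fun x => (InnerProductSpace.toDual ℝ E).symm (LinearMap.toContinuousLinearMap (Q x))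
      map_add' := by intro x y; simp
      map_smul' := by intro r x; simp }
  refine ⟨LinearMap.toContinuousLinearMap q', fun x w => ?_⟩
  simp [q']

/-- A Jacobi frame for the boundary condition. -/
structure Frame (τ : ℝ) (R : ℝ → E →L[ℝ] E) (E₀ : Submodule ℝ E) [E₀.HasOrthogonalProjection]
    (q : E →L[ℝ] E) (A B : ℝ → E →L[ℝ] E) : Prop where
  A0 : A 0 = E₀.starProjection
  B0 : B 0 = ContinuousLinearMap.id ℝ E - E₀.starProjection - q ∘L E₀.starProjection
  dA : ∀ t ∈ Icc 0 τ, HasDerivWithinAt A (B t) (Icc 0 τ) t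
  dB : ∀ t ∈ Icc 0 τ, HasDerivWithinAt B (-(R t ∘L A t)) (Icc 0 τ) t

lemma exists_frame [FiniteDimensional ℝ E] (τ : ℝ) (hτ : 0 < τ)
    (R : ℝ → E →L[ℝ] E) (hRcont : ContinuousOn R (Set.Icc 0 τ)) (E₀ : Submodule ℝ E)
    (q : E →L[ℝ] E) : ∃ A B, Frame τ R E₀ q A B := by
  have : CompleteSpace E := FiniteDimensional.complete ℝ E
  let F : ℝ → ((E →L[ℝ] E) × (E →L[ℝ] E)) →L[ℝ] ((E →L[ℝ] E) × (E →L[ℝ] E)) := fun t =>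
    (ContinuousLinearMap.inl ℝ (E →L[ℝ] E) (E →L[ℝ] E)) ∘L
      (ContinuousLinearMap.snd ℝ (E →L[ℝ] E) (E →L[ℝ] E)) -
    (ContinuousLinearMap.inr ℝ (E →L[ℝ] E) (E →L[ℝ] E)) ∘L
      ((ContinuousLinearMap.compL ℝ E E E (R t)) ∘L
        (ContinuousLinearMap.fst ℝ (E →L[ℝ] E) (E →L[ℝ] E)))
  have hF : ContinuousOn F (Icc 0 τ) := by
    apply ContinuousOn.sub continuousOn_const
    apply ContinuousOn.clm_comp continuousOn_const
    apply ContinuousOn.clm_comp _ continuousOn_const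
    exact (ContinuousLinearMap.compL ℝ E E E).continuous.comp_continuousOn hRcont
  obtain ⟨α, h0, hα⟩ := exists_linear_ode τ hτ F hF (E₀.starProjection,
    ContinuousLinearMap.id ℝ E - E₀.starProjection - q ∘L E₀.starProjection)
  have e : ∀ t, F t (α t) = ((α t).2, -(R t ∘L (α t).1)) := by
    intro t; simp [F]
  refine ⟨fun t => (α t).1, fun t => (α t).2, by simp [h0], by simp [h0], ?_, ?_⟩
  · intro t ht
    have := (ContinuousLinearMap.fst ℝ (E →L[ℝ] E) (E →L[ℝ] E)).hasFDerivAt.comp_hasDerivWithinAt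
      t (hα t ht)
    rw [e] at this
    exact this
  · intro t ht
    have := (ContinuousLinearMap.snd ℝ (E →L[ℝ] E) (E →L[ℝ] E)).hasFDerivAt.comp_hasDerivWithinAt
      t (hα t ht)
    rw [e] at this
    exact this

variable {τ : ℝ} {R : ℝ → E →L[ℝ] E} {E₀ : Submodule ℝ E} [E₀.HasOrthogonalProjection]
  {q : E →L[ℝ] E} {A B : ℝ → E →L[ℝ] E}

lemma hasDerivWithinAt_clm_apply_const {A : ℝ → E →L[ℝ] E} {A' : E →L[ℝ] E} {s : Set ℝ} {t : ℝ}
    (h : HasDerivWithinAt A A' s t) (z : E) : HasDerivWithinAt (fun t => A t z) (A' z) s t := by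
  simpa using h.clm_apply (hasDerivWithinAt_const t s z)

lemma Frame.wronskian (hfr : Frame τ R E₀ q A B) (hτ : 0 < τ)
    (hRsa : ∀ t ∈ Set.Icc (0:ℝ) τ, ∀ u v : E, ⟪R t u, v⟫ = ⟪u, R t v⟫)
    (hq : ∀ x ∈ E₀, ∀ y ∈ E₀, ⟪q x, y⟫ = ⟪q y, x⟫) :
    ∀ t ∈ Icc 0 τ, ∀ x y, ⟪B t x, A t y⟫ = ⟪A t x, B t y⟫ := by
  intro t ht x y
  have hd : ∀ t ∈ Icc 0 τ, HasDerivWithinAt (fun t => ⟪B t x, A t y⟫ - ⟪A t x, B t y⟫) 0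
      (Icc 0 τ) t := by
    intro t ht
    have hA := hasDerivWithinAt_clm_apply_const (hfr.dA t ht)
    have hB := hasDerivWithinAt_clm_apply_const (hfr.dB t ht)
    have := ((hB x).inner ℝ (hA y)).sub ((hA x).inner ℝ (hB y))
    refine HasDerivWithinAt.congr_deriv this ?_
    simp only [_root_.neg_apply, ContinuousLinearMap.comp_apply]
    rw [inner_neg_left, inner_neg_right, hRsa t ht]
    ring
  have h := constant_of_derivWithin_zero (fun t ht => (hd t ht).differentiableWithinAt)
    (fun t ht => (hd t ⟨ht.1, ht.2.le⟩).derivWithin (uniqueDiffOn_Icc hτ t ⟨ht.1, ht.2.le⟩)) t ht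
  simp only [hfr.A0, hfr.B0] at h
  rw [← sub_eq_zero, h]
  have hx := E₀.starProjection_apply_mem x
  have hy := E₀.starProjection_apply_mem y
  have ox := E₀.sub_starProjection_mem_orthogonal x _ hy
  have oy := E₀.sub_starProjection_mem_orthogonal y _ hx
  have h3 := hq _ hx _ hy
  rw [real_inner_comm] at ox
  simp only [_root_.sub_apply, ContinuousLinearMap.id_apply,
    ContinuousLinearMap.comp_apply] at *
  rw [inner_sub_left, ox, inner_sub_right, oy, h3, real_inner_comm]
  simp

lemma Frame.injective (hfr : Frame τ R E₀ q A B) (hτ : 0 < τ)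
    (hRcont : ContinuousOn R (Set.Icc 0 τ)) (Q : E →ₗ[ℝ] E →ₗ[ℝ] ℝ)
    (hq : ∀ x w, ⟪q x, w⟫ = Q x w)
    (hno : ∀ a : ℝ, ¬ IsFocalPoint R E₀ Q τ a) (a : ℝ) (ha : a ∈ Ioc 0 τ) (z : E)
    (hz : A a z = 0) : z = 0 := by
  by_contra hz0
  apply hno a
  have hsub : Icc 0 a ⊆ Icc 0 τ := Icc_subset_Icc_right ha.2
  have hU := uniqueDiffOn_Icc ha.1
  have hA : ∀ t ∈ Icc 0 a, HasDerivWithinAt (fun t => A t z) (B t z) (Icc 0 a) t := fun t ht =>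
    (hasDerivWithinAt_clm_apply_const (hfr.dA t (hsub ht)) z).mono hsub
  have hB : ∀ t ∈ Icc 0 a, HasDerivWithinAt (fun t => B t z) (-(R t (A t z))) (Icc 0 a) t :=
    fun t ht => by
      simpa using (hasDerivWithinAt_clm_apply_const (hfr.dB t (hsub ht)) z).mono hsub
  have hA' : ∀ t ∈ Icc 0 a, derivWithin (fun t => A t z) (Icc 0 a) t = B t z := fun t ht =>
    (hA t ht).derivWithin (hU t ht)
  have hB' : ∀ t ∈ Icc 0 a, derivWithin (fun t => B t z) (Icc 0 a) t = -(R t (A t z)) := fun t ht =>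
    (hB t ht).derivWithin (hU t ht)
  have h0 : (0:ℝ) ∈ Icc 0 a := ⟨le_rfl, ha.1.le⟩
  refine ⟨ha, fun t => A t z, ⟨?_, ?_, ?_, ?_, hz⟩, ?_⟩
  · rw [show (2 : WithTop ℕ∞) = 1 + 1 by norm_num, contDiffOn_succ_iff_derivWithin hU]
    refine ⟨fun t ht => (hA t ht).differentiableWithinAt, by simp, ?_⟩
    apply ContDiffOn.congr (f := fun t => B t z) _ hA'
    rw [contDiffOn_one_iff_derivWithin hU]
    refine ⟨fun t ht => (hB t ht).differentiableWithinAt, ?_⟩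
    apply ContinuousOn.congr (f := fun t => -(R t (A t z))) _ hB'
    apply ContinuousOn.neg
    exact (hRcont.mono hsub).clm_apply (fun t ht => (hA t ht).continuousWithinAt)
  · intro t ht
    rw [derivWithin_congr hA' (hA' t ht), hB' t ht]
    simp
  · simp only [hfr.A0]; exact E₀.starProjection_apply_mem z
  · intro w hw
    rw [hA' 0 h0, ← hq]
    simp only [hfr.B0, hfr.A0]
    have ox := E₀.sub_starProjection_mem_orthogonal z w hw
    rw [real_inner_comm] at ox
    simp [inner_sub_left] at ox ⊢
    linarith
  · by_contra hcon
    push Not at hcon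
    have e0 := hcon 0 h0
    have e1 : B 0 z = 0 := by
      rw [← hA' 0 h0, derivWithin_congr hcon e0]
      simp
    rw [hfr.A0] at e0
    rw [hfr.B0] at e1
    simp [e0] at e1
    exact hz0 e1

lemma Frame.lower (hfr : Frame τ R E₀ q A B) (hτ : 0 < τ) :
    ∀ᶠ t in 𝓝[>] (0:ℝ), ∀ z, t / 4 * ‖z‖ ≤ ‖A t z‖ := by
  have hmem : Icc 0 τ ∈ 𝓝[>] (0:ℝ) := Icc_mem_nhdsGT hτ
  set P := E₀.starProjection with hP
  have hPP : ∀ z, P (P z) = P z := fun z =>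
    Submodule.starProjection_eq_self_iff.2 (E₀.starProjection_apply_mem z)
  set I := ContinuousLinearMap.id ℝ E
  have hA := (hfr.dA 0 ⟨le_rfl, hτ.le⟩).mono_of_mem_nhdsWithin hmem
  have h1 : Tendsto (fun t => A t ∘L P) (𝓝[>] 0) (𝓝 P) := by
    have := (hA.continuousWithinAt.clm_comp (continuousWithinAt_const (b := P))).tendsto
    convert this using 2
    ext z; simp [hfr.A0, hPP, ← hP]
  have h2 : Tendsto (fun t => t⁻¹ • (A t ∘L (I - P))) (𝓝[>] 0) (𝓝 (I - P)) := by
    have h3 := hA.clm_comp (hasDerivWithinAt_const (0:ℝ) (Ioi 0) (I - P))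
    rw [hasDerivWithinAt_iff_tendsto_slope' (by simp)] at h3
    have e1 : A 0 ∘L (I - P) = 0 := by
      ext z; simp [hfr.A0, hPP, ← hP, I]
    have e2 : B 0 ∘L (I - P) + A 0 ∘L 0 = I - P := by
      ext z; simp [hfr.B0, hPP, ← hP, I]
    rw [e2] at h3
    refine h3.congr fun t => ?_
    simp [slope, e1]
  have h3 := h1.add h2
  rw [show P + (I - P) = I by abel] at h3
  have h4 := Metric.tendsto_nhds.1 h3 (1/2) (by norm_num)
  filter_upwards [h4, Ioo_mem_nhdsGT (show (0:ℝ) < 1 by norm_num)] with t ht ht1 z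
  set M := A t ∘L P + t⁻¹ • A t ∘L (I - P) with hM
  rw [dist_eq_norm] at ht
  set y := P z + t • (z - P z) with hy
  have hPy : P y = P z := by simp [hy, hPP]
  have ht0 : t ≠ 0 := ht1.1.ne'
  have hMy : M y = A t z := by
    have : y - P y = t • (z - P z) := by rw [hPy, hy]; abel
    have e : M y = A t (P y) + t⁻¹ • A t (y - P y) := by simp [hM, I]
    rw [e, this, hPy, map_smul, smul_smul, inv_mul_cancel₀ ht0, one_smul, ← map_add]
    congr 1; abel
  have h5 : ‖M y - y‖ ≤ 1/2 * ‖y‖ := by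
    have := (M - I).le_opNorm y
    simp only [_root_.sub_apply, I, ContinuousLinearMap.id_apply] at this
    refine this.trans ?_
    gcongr
  have h6 : ‖y‖ - ‖A t z‖ ≤ ‖M y - y‖ := by
    rw [← hMy, norm_sub_rev]; exact norm_sub_norm_le _ _
  have h7 : t • z = y - (1 - t) • P y := by rw [hPy, hy]; module
  have h8 : t * ‖z‖ ≤ ‖y‖ + ‖y‖ := by
    rw [← Real.norm_of_nonneg ht1.1.le, ← norm_smul, h7]
    refine (norm_sub_le _ _).trans ?_
    gcongr
    rw [norm_smul, Real.norm_of_nonneg (by linarith [ht1.2])]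
    have := E₀.starProjection_norm_le
    have h9 : ‖P y‖ ≤ ‖y‖ := by
      refine (P.le_opNorm y).trans ?_
      exact mul_le_of_le_one_left (norm_nonneg _) this
    have : (1 - t) * ‖P y‖ ≤ 1 * ‖P y‖ := by gcongr; linarith [ht1.1]
    linarith
  linarith

lemma Frame.tendsto (hfr : Frame τ R E₀ q A B) (hτ : 0 < τ) {v : ℝ → E} {v1 : E}
    (hv : HasDerivWithinAt v v1 (Icc 0 τ) 0) (hv0 : v 0 ∈ E₀)
    (hv1 : ∀ w ∈ E₀, ⟪v1, w⟫ = - ⟪q (v 0), w⟫) (c : ℝ → E)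
    (hc : ∀ t ∈ Ioc 0 τ, A t (c t) = v t) :
    ∃ c0, A 0 c0 = v 0 ∧ B 0 c0 = v1 ∧ Tendsto c (𝓝[>] 0) (𝓝 c0) := by
  have hmem : Icc 0 τ ∈ 𝓝[>] (0:ℝ) := Icc_mem_nhdsGT hτ
  set P := E₀.starProjection with hP
  have hPv : P (v 0) = v 0 := Submodule.starProjection_eq_self_iff.2 hv0
  have hPo : P (v1 + q (v 0)) = 0 := by
    rw [hP, Submodule.starProjection_apply_eq_zero_iff]
    intro w hw
    rw [real_inner_comm, inner_add_left, hv1 w hw]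
    simp
  refine ⟨v 0 + (v1 + q (v 0)), ?_, ?_, ?_⟩
  · rw [hfr.A0, map_add, hPo, hPv, add_zero]
  · rw [hfr.B0]
    simp only [_root_.sub_apply, ContinuousLinearMap.id_apply,
      ContinuousLinearMap.comp_apply]
    rw [map_add P, hPo, hPv]; simp
  set c0 := v 0 + (v1 + q (v 0)) with hc0
  have hA0 : A 0 c0 = v 0 := by rw [hfr.A0, map_add, hPo, hPv, add_zero]
  have hB0 : B 0 c0 = v1 := by
    rw [hfr.B0]
    simp only [_root_.sub_apply, ContinuousLinearMap.id_apply,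
      ContinuousLinearMap.comp_apply]
    rw [map_add P, hPo, hPv]; simp [hc0]
  have hd := (hv.sub (hasDerivWithinAt_clm_apply_const (hfr.dA 0 ⟨le_rfl, hτ.le⟩) c0)).mono_of_mem_nhdsWithin hmem
  rw [hB0, sub_self, hasDerivWithinAt_iff_isLittleO] at hd
  rw [Metric.tendsto_nhds]
  intro ε hε
  have h1 := hd.def (show 0 < ε / 8 by positivity)
  filter_upwards [h1, hfr.lower hτ, Ioc_mem_nhdsGT hτ] with t h1 h2 ht
  have h3 := h2 (c t - c0)
  rw [map_sub, hc t ht] at h3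
  simp [hA0] at h1
  rw [abs_of_pos ht.1] at h1
  rw [dist_eq_norm]
  have h4 : t / 4 * ‖c t - c0‖ ≤ ε / 8 * t := h3.trans h1
  have h5 : t / 4 * ‖c t - c0‖ ≤ t / 4 * (ε / 2) := by linarith
  have := le_of_mul_le_mul_left h5 (by linarith [ht.1])
  linarith

end Frame

section Piecewise

lemma le_of_deriv_nonpos_off_finite {f f' : ℝ → ℝ} (S : Finset ℝ) : ∀ a b : ℝ, a ≤ b →
    ContinuousOn f (Icc a b) → (∀ x ∈ Ioo a b, x ∉ S → HasDerivAt f (f' x) x) →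
    (∀ x ∈ Ioo a b, x ∉ S → f' x ≤ 0) → f b ≤ f a := by
  classical
  induction S using Finset.induction_on with
  | empty =>
    intro a b hab hc hd hn
    refine antitoneOn_of_deriv_nonpos (convex_Icc a b) hc ?_ ?_ (left_mem_Icc.2 hab)
      (right_mem_Icc.2 hab) hab
    · rw [interior_Icc]
      intro x hx
      exact (hd x hx (by simp)).differentiableAt.differentiableWithinAt
    · rw [interior_Icc]
      intro x hx
      rw [(hd x hx (by simp)).deriv]
      exact hn x hx (by simp)
  | insert s S _ ih =>
    intro a b hab hc hd hn
    by_cases hs : s ∈ Ioo a b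
    · have h1 : f s ≤ f a := by
        apply ih a s hs.1.le (hc.mono (Icc_subset_Icc_right hs.2.le))
        · intro x hx hxS
          exact hd x ⟨hx.1, hx.2.trans hs.2⟩ (by simp [hxS, hx.2.ne])
        · intro x hx hxS
          exact hn x ⟨hx.1, hx.2.trans hs.2⟩ (by simp [hxS, hx.2.ne])
      have h2 : f b ≤ f s := by
        apply ih s b hs.2.le (hc.mono (Icc_subset_Icc_left hs.1.le))
        · intro x hx hxS
          exact hd x ⟨hs.1.trans hx.1, hx.2⟩ (by simp [hxS, hx.1.ne'])
        · intro x hx hxS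
          exact hn x ⟨hs.1.trans hx.1, hx.2⟩ (by simp [hxS, hx.1.ne'])
      exact h2.trans h1
    · apply ih a b hab hc
      · intro x hx hxS
        exact hd x hx (by simp [hxS]; rintro rfl; exact hs hx)
      · intro x hx hxS
        exact hn x hx (by simp [hxS]; rintro rfl; exact hs hx)

lemma exists_piece {k : ℕ} (s : Fin (k + 1) → ℝ) (t : ℝ) (h0 : s 0 ≤ t)
    (h1 : t ≤ s (Fin.last k)) (hk : s 0 < s (Fin.last k)) :
    ∃ i : Fin k, t ∈ Icc (s i.castSucc) (s i.succ) := by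
  by_contra hcon
  have hcon : ∀ i : Fin k, s i.castSucc ≤ t → s i.succ < t := by
    intro i hi
    by_contra h
    exact hcon ⟨i, hi, not_lt.1 h⟩
  have h : ∀ j : Fin (k + 1), s j ≤ t := by
    intro j
    induction j using Fin.induction with
    | zero => exact h0
    | succ i ih => exact (hcon i ih).le
  cases k with
  | zero => exact absurd hk (by simp)
  | succ k =>
    have := hcon (Fin.last k) (h _)
    rw [Fin.succ_last] at this
    linarith

lemma piecewise_facts {τ : ℝ} (hτ : 0 < τ) {v : ℝ → E} (hv : PiecewiseContDiffOn 2 v 0 τ) :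
    ∃ S : Finset ℝ, (∀ t ∈ Ioo 0 τ, t ∉ S → HasDerivAt v (derivWithin v (Icc 0 τ) t) t ∧
      ContinuousAt (derivWithin v (Icc 0 τ)) t) ∧
      HasDerivWithinAt v (derivWithin v (Icc 0 τ) 0) (Icc 0 τ) 0 ∧
      IntegrableOn (fun t => ⟪derivWithin v (Icc 0 τ) t, derivWithin v (Icc 0 τ) t⟫)
        (Icc 0 τ) := by
  classical
  obtain ⟨-, k, s, hs, hs0, hsl, hC⟩ := hv
  have hk : s 0 < s (Fin.last k) := by rw [hs0, hsl]; exact hτ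
  have hlt : ∀ i : Fin k, s i.castSucc < s i.succ := fun i => hs Fin.castSucc_lt_succ
  have hge : ∀ j, 0 ≤ s j := fun j => by rw [← hs0]; exact hs.monotone (Fin.zero_le j)
  have hle : ∀ j, s j ≤ τ := fun j => by rw [← hsl]; exact hs.monotone (Fin.le_last j)
  have hd : ∀ i : Fin k, ∀ x ∈ Ioo (s i.castSucc) (s i.succ), derivWithin v (Icc 0 τ) x =
      derivWithin v (Icc (s i.castSucc) (s i.succ)) x := by
    intro i x hx
    rw [derivWithin_of_mem_nhds (Icc_mem_nhds hx.1 hx.2), derivWithin_of_mem_nhds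
      (Icc_mem_nhds ((hge _).trans_lt hx.1) (hx.2.trans_le (hle _)))]
  have hcont : ∀ i : Fin k, ContinuousOn (derivWithin v (Icc (s i.castSucc) (s i.succ)))
      (Icc (s i.castSucc) (s i.succ)) := fun i =>
    (hC i).continuousOn_derivWithin (uniqueDiffOn_Icc (hlt i)) (by norm_num)
  have hdiff : ∀ i : Fin k, DifferentiableOn ℝ v (Icc (s i.castSucc) (s i.succ)) := fun i =>
    (hC i).differentiableOn (by norm_num)
  refine ⟨Finset.univ.image s, ?_, ?_, ?_⟩
  · intro t ht htS
    obtain ⟨i, hi⟩ := exists_piece s t (by rw [hs0]; exact ht.1.le) (by rw [hsl]; exact ht.2.le) hk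
    have hne : ∀ j, s j ≠ t := fun j h => htS (by simp [← h])
    have hi' : t ∈ Ioo (s i.castSucc) (s i.succ) :=
      ⟨lt_of_le_of_ne hi.1 (hne _), lt_of_le_of_ne hi.2 (hne _).symm⟩
    have hn := Icc_mem_nhds hi'.1 hi'.2
    constructor
    · rw [hd i t hi']
      exact ((hdiff i t hi).hasDerivWithinAt).hasDerivAt hn
    · refine ContinuousAt.congr ((hcont i).continuousAt hn) ?_
      filter_upwards [Ioo_mem_nhds hi'.1 hi'.2] with x hx
      exact (hd i x hx).symm
  · obtain ⟨i, hi⟩ := exists_piece s 0 (by rw [hs0]) (by rw [hsl]; exact hτ.le) hk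
    have h0 : s i.castSucc = 0 := le_antisymm hi.1 (hge _)
    have h1 : 0 < s i.succ := by rw [← h0]; exact hlt i
    have := hdiff i 0 hi
    rw [h0] at this
    apply DifferentiableWithinAt.hasDerivWithinAt
    exact this.mono_of_mem_nhdsWithin
      (mem_of_superset (inter_mem_nhdsWithin _ (Iio_mem_nhds h1)) fun x hx => ⟨hx.1.1, hx.2.le⟩)
  · have hsub : Icc 0 τ ⊆ ⋃ i : Fin k, Icc (s i.castSucc) (s i.succ) := by
      intro t ht
      obtain ⟨i, hi⟩ := exists_piece s t (by rw [hs0]; exact ht.1) (by rw [hsl]; exact ht.2) hk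
      exact mem_iUnion.2 ⟨i, hi⟩
    refine IntegrableOn.mono_set ?_ hsub
    rw [integrableOn_finite_iUnion]
    intro i
    have := (((hcont i).inner (𝕜 := ℝ) (hcont i)).integrableOn_Icc (μ := volume))
    rw [integrableOn_Icc_iff_integrableOn_Ioo] at this ⊢
    refine this.congr_fun (fun x hx => ?_) measurableSet_Ioo
    simp only [hd i x hx]

end Piecewise

section Pos

lemma isUnit_of_inj [FiniteDimensional ℝ E] (T : E →L[ℝ] E) (h : ∀ z, T z = 0 → z = 0) :
    IsUnit T := by
  have hc : CompleteSpace E := FiniteDimensional.complete ℝ E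
  have hi : Function.Injective (T : E →ₗ[ℝ] E) := by
    rw [← LinearMap.ker_eq_bot, LinearMap.ker_eq_bot']
    exact h
  rw [ContinuousLinearMap.isUnit_iff_bijective]
  exact ⟨hi, LinearMap.injective_iff_surjective.1 hi⟩

lemma indexForm_pos [FiniteDimensional ℝ E]
    (τ : ℝ) (hτ : 0 < τ)
    (R : ℝ → E →L[ℝ] E) (hRcont : ContinuousOn R (Set.Icc 0 τ))
    (hRsa : ∀ t ∈ Set.Icc (0:ℝ) τ, ∀ u v : E, ⟪R t u, v⟫ = ⟪u, R t v⟫)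
    (E₀ : Submodule ℝ E) (Q : E →ₗ[ℝ] E →ₗ[ℝ] ℝ)
    (hQsymm : ∀ x ∈ E₀, ∀ y ∈ E₀, Q x y = Q y x)
    (hno : ∀ a : ℝ, ¬ IsFocalPoint R E₀ Q τ a)
    (v : ℝ → E) (hv : InOmega E₀ Q τ v) (hne : ∃ t ∈ Set.Icc (0:ℝ) τ, v t ≠ 0) :
    0 < indexForm R Q τ v := by
  have hcomp : CompleteSpace E := FiniteDimensional.complete ℝ E
  obtain ⟨hpw, hv0, hv1, hvτ⟩ := hv
  obtain ⟨S, hS, hd0, hint⟩ := piecewise_facts hτ hpw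
  have hvc := hpw.1
  obtain ⟨q, hq⟩ := exists_riesz Q
  obtain ⟨A, B, hfr⟩ := exists_frame τ hτ R hRcont E₀ q
  have hW := hfr.wronskian hτ hRsa (fun x hx y hy => by rw [hq, hq, hQsymm x hx y hy])
  have hinj := hfr.injective hτ hRcont Q hq hno
  have hU : ∀ t ∈ Ioc 0 τ, IsUnit (A t) := fun t ht => isUnit_of_inj _ (hinj t ht)
  set v' := derivWithin v (Icc 0 τ) with hv'
  let c : ℝ → E := fun t => Ring.inverse (A t) (v t)
  have hAc : ∀ t ∈ Ioc 0 τ, A t (c t) = v t := by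
    intro t ht
    have := Ring.mul_inverse_cancel _ (hU t ht)
    exact congrArg (fun T : E →L[ℝ] E => T (v t)) this
  obtain ⟨c0, hAc0, hBc0, hct⟩ := hfr.tendsto hτ hd0 hv0 (fun w hw => by rw [hv1 w hw, hq]) c hAc
  have hIcc : Ioc 0 τ ⊆ Icc 0 τ := Ioc_subset_Icc_self
  have hAcont : ContinuousOn A (Icc 0 τ) := fun t ht => (hfr.dA t ht).continuousWithinAt
  have hBcont : ContinuousOn B (Icc 0 τ) := fun t ht => (hfr.dB t ht).continuousWithinAt
  have hcc : ContinuousOn c (Ioc 0 τ) := by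
    refine ContinuousOn.clm_apply ?_ (hvc.mono hIcc)
    intro t ht
    obtain ⟨u, hu⟩ := hU t ht
    have := NormedRing.inverse_continuousAt u
    rw [hu] at this
    exact this.comp_continuousWithinAt (hAcont.mono hIcc t ht)
  let g : ℝ → ℝ := fun t => ⟪v' t, v' t⟫ - ⟪R t (v t), v t⟫
  have hRv : ContinuousOn (fun t => ⟪R t (v t), v t⟫) (Icc 0 τ) :=
    (hRcont.clm_apply hvc).inner hvc
  have hg : IntegrableOn g (Icc 0 τ) := hint.sub hRv.integrableOn_Icc
  have hgi : IntervalIntegrable g volume 0 τ :=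
    (intervalIntegrable_iff_integrableOn_Icc_of_le hτ.le).2 hg
  have hprim : ContinuousOn (fun t => ∫ x in t..τ, g x) (Icc 0 τ) := by
    have := intervalIntegral.continuousOn_primitive_interval_left (f := g) (μ := volume)
      (a := 0) (b := τ) (by rwa [uIcc_of_le hτ.le])
    rwa [uIcc_of_le hτ.le] at this
  let H : ℝ → ℝ := fun t => (∫ x in t..τ, g x) + ⟪B t (c t), v t⟫
  have hHc : ContinuousOn H (Ioc 0 τ) :=
    (hprim.mono hIcc).add (((hBcont.mono hIcc).clm_apply hcc).inner (hvc.mono hIcc))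
  have hHτ : H τ = 0 := by simp [H, hvτ]
  have hmem0 : Icc 0 τ ∈ 𝓝[>] (0:ℝ) := Icc_mem_nhdsGT hτ
  have h0m : (0:ℝ) ∈ Icc 0 τ := ⟨le_rfl, hτ.le⟩
  have hH0 : Tendsto H (𝓝[>] 0) (𝓝 (indexForm R Q τ v)) := by
    have h1 : Tendsto (fun t => ∫ x in t..τ, g x) (𝓝[>] 0) (𝓝 (∫ x in (0:ℝ)..τ, g x)) :=
      ((hprim 0 h0m).mono_of_mem_nhdsWithin hmem0).tendsto
    have h2 : Tendsto B (𝓝[>] 0) (𝓝 (B 0)) := ((hBcont 0 h0m).mono_of_mem_nhdsWithin hmem0).tendsto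
    have h3 : Tendsto v (𝓝[>] 0) (𝓝 (v 0)) := ((hvc 0 h0m).mono_of_mem_nhdsWithin hmem0).tendsto
    have h5 : Tendsto (fun t => B t (c t)) (𝓝[>] 0) (𝓝 (B 0 c0)) :=
      ((isBoundedBilinearMap_apply (𝕜 := ℝ) (E := E) (F := E)).continuous.tendsto (B 0, c0)).comp
        (h2.prodMk_nhds hct)
    have h4 := h1.add (h5.inner h3)
    rw [hBc0, hv1 _ hv0, add_comm] at h4
    exact h4
  have hcd : ∀ t ∈ Ioo 0 τ, t ∉ S → HasDerivAt c (deriv c t) t := by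
    intro t ht htS
    have hA := (hfr.dA t (Ioo_subset_Icc_self ht)).hasDerivAt (Icc_mem_nhds ht.1 ht.2)
    apply DifferentiableAt.hasDerivAt
    refine DifferentiableAt.clm_apply ?_ (hS t ht htS).1.differentiableAt
    exact (differentiableAt_inverse (𝕜 := ℝ) (hU t (Ioo_subset_Ioc_self ht))).comp t
      hA.differentiableAt
  have hHd : ∀ t ∈ Ioo 0 τ, t ∉ S → HasDerivAt H (-‖A t (deriv c t)‖ ^ 2) t := by
    intro t ht htS
    have htI := Ioo_subset_Icc_self ht
    have hn := Icc_mem_nhds ht.1 ht.2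
    have hA := (hfr.dA t htI).hasDerivAt hn
    have hB := (hfr.dB t htI).hasDerivAt hn
    have hc := hcd t ht htS
    have hvd := (hS t ht htS).1
    have hv'c := (hS t ht htS).2
    have e1 : v' t = B t (c t) + A t (deriv c t) := by
      refine hvd.unique ((hA.clm_apply hc).congr_of_eventuallyEq ?_)
      filter_upwards [Ioo_mem_nhds ht.1 ht.2] with x hx
      exact (hAc x (Ioo_subset_Ioc_self hx)).symm
    have hgc : ContinuousAt g t := (hv'c.inner hv'c).sub (hRv.continuousAt hn)
    have hI : HasDerivAt (fun u => ∫ x in u..τ, g x) (-g t) t := by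
      apply intervalIntegral.integral_hasDerivAt_left _ _ hgc
      · refine hgi.mono_set ?_
        rw [uIcc_of_le hτ.le, uIcc_of_le ht.2.le]
        exact Icc_subset_Icc_left ht.1.le
      · exact ⟨Icc 0 τ, hn, hg.aestronglyMeasurable⟩
    have := hI.add ((hB.clm_apply hc).inner ℝ hvd)
    refine HasDerivAt.congr_deriv this ?_
    have hA' := hAc t (Ioo_subset_Ioc_self ht)
    have w := hW t htI (deriv c t) (c t)
    rw [hA'] at w
    simp only [g, _root_.neg_apply, ContinuousLinearMap.comp_apply, hA']
    rw [e1]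
    rw [← real_inner_self_eq_norm_sq]
    simp only [inner_add_left, inner_add_right, inner_neg_left, w]
    rw [real_inner_comm (A t (deriv c t)) (B t (c t))]
    ring
  have hanti : ∀ s t, 0 < s → s ≤ t → t ≤ τ → H t ≤ H s := by
    intro s t hs hst ht
    refine le_of_deriv_nonpos_off_finite (f' := fun t => -‖A t (deriv c t)‖ ^ 2) S s t hst
      (hHc.mono fun x hx => ⟨hs.trans_le hx.1, hx.2.trans ht⟩) ?_ ?_
    · intro x hx hxS
      exact hHd x ⟨hs.trans hx.1, hx.2.trans_le ht⟩ hxS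
    · intro x _ _
      simp
  by_contra hneg
  rw [not_lt] at hneg
  have hHz : ∀ t ∈ Ioc 0 τ, H t = 0 := by
    intro t ht
    apply le_antisymm
    · refine le_trans ?_ hneg
      apply ge_of_tendsto hH0
      filter_upwards [Ioc_mem_nhdsGT ht.1] with s hs
      exact hanti s t hs.1 hs.2 ht.2
    · rw [← hHτ]; exact hanti t τ ht.1 ht.2 le_rfl
  have hc' : ∀ t ∈ Ioo 0 τ, t ∉ S → deriv c t = 0 := by
    intro t ht htS
    have h1 : HasDerivAt H 0 t := by
      refine (hasDerivAt_const t (0:ℝ)).congr_of_eventuallyEq ?_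
      filter_upwards [Ioo_mem_nhds ht.1 ht.2] with x hx
      exact hHz x (Ioo_subset_Ioc_self hx)
    have h2 := (hHd t ht htS).unique h1
    apply hinj t (Ioo_subset_Ioc_self ht)
    simpa using h2
  have hcτ : c τ = 0 := by simp [c, hvτ]
  have hcz : ∀ t ∈ Ioc 0 τ, c t = 0 := by
    intro t ht
    have := le_of_deriv_nonpos_off_finite (f := fun t => -⟪c t, c t⟫) (f' := fun _ => 0) S t τ ht.2
      (by
        have h := hcc.mono (fun x (hx : x ∈ Icc t τ) => (⟨ht.1.trans_le hx.1, hx.2⟩ : x ∈ Ioc 0 τ))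
        exact (h.inner h).neg)
      (by
        intro x hx hxS
        have hx' : x ∈ Ioo 0 τ := ⟨ht.1.trans hx.1, hx.2⟩
        have h := hcd x hx' hxS
        rw [hc' x hx' hxS] at h
        refine HasDerivAt.congr_deriv (h.inner ℝ h).neg ?_
        simp)
      (by simp)
    simp only [hcτ, inner_zero_left, neg_zero] at this
    rw [real_inner_self_eq_norm_sq] at this
    have h2 : ‖c t‖ ^ 2 = 0 := by nlinarith [sq_nonneg ‖c t‖]
    simpa using h2
  have hc00 : c0 = 0 := by
    refine tendsto_nhds_unique hct (tendsto_const_nhds.congr' ?_)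
    filter_upwards [Ioc_mem_nhdsGT hτ] with t ht
    exact (hcz t ht).symm
  obtain ⟨t, ht, hvt⟩ := hne
  apply hvt
  rcases eq_or_lt_of_le ht.1 with h | h
  · rw [← h, ← hAc0, hc00, map_zero]
  · rw [← hAc t ⟨h, ht.2⟩, hcz t ⟨h, ht.2⟩, map_zero]

end Pos

section Forward

lemma not_pos_of_focal [FiniteDimensional ℝ E]
    (τ : ℝ) (hτ : 0 < τ)
    (R : ℝ → E →L[ℝ] E) (hRcont : ContinuousOn R (Set.Icc 0 τ))
    (E₀ : Submodule ℝ E) (Q : E →ₗ[ℝ] E →ₗ[ℝ] ℝ)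
    (a : ℝ) (ha : IsFocalPoint R E₀ Q τ a) :
    ∃ v : ℝ → E, InOmega E₀ Q τ v ∧ (∃ t ∈ Set.Icc (0:ℝ) τ, v t ≠ 0) ∧
      indexForm R Q τ v = 0 := by
  obtain ⟨⟨ha0, haτ⟩, u, ⟨hu, hJ, hu0, hu1, hua⟩, t₁, ht₁, hne⟩ := ha
  have hU := uniqueDiffOn_Icc ha0
  have hUτ := uniqueDiffOn_Icc hτ
  have hsub : Icc 0 a ⊆ Icc 0 τ := Icc_subset_Icc_right haτ
  let v : ℝ → E := fun t => if t ≤ a then u t else 0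
  set u' := derivWithin u (Icc 0 a) with hu'
  have hv1 : EqOn v u (Icc 0 a) := fun t ht => by simp [v, ht.2]
  have hv2 : EqOn v (fun _ => 0) (Icc a τ) := fun t ht => by
    simp only [v]
    split_ifs with h
    · rw [le_antisymm h ht.1, hua]
    · rfl
  have hd1 : ∀ t ∈ Icc 0 a, HasDerivWithinAt u (u' t) (Icc 0 a) t := fun t ht =>
    ((hu.differentiableOn (by norm_num)) t ht).hasDerivWithinAt
  have hu'C : ContDiffOn ℝ 1 u' (Icc 0 a) := hu.derivWithin hU (by norm_num)
  have hd2 : ∀ t ∈ Icc 0 a, HasDerivWithinAt u' (-(R t (u t))) (Icc 0 a) t := fun t ht => by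
    have := ((hu'C.differentiableOn (by norm_num)) t ht).hasDerivWithinAt
    rwa [eq_neg_of_add_eq_zero_left (hJ t ht)] at this
  have hvd : ∀ t ∈ Ico 0 a, derivWithin v (Icc 0 τ) t = u' t := by
    intro t ht
    have ht' : t ∈ Icc 0 a := ⟨ht.1, ht.2.le⟩
    have h1 : HasDerivWithinAt v (u' t) (Icc 0 a) t := (hd1 t ht').congr hv1 (hv1 ht')
    have h2 : HasDerivWithinAt v (u' t) (Icc 0 τ) t := h1.mono_of_mem_nhdsWithin
      (mem_of_superset (inter_mem_nhdsWithin _ (Iio_mem_nhds ht.2)) fun x hx => ⟨hx.1.1, hx.2.le⟩)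
    exact h2.derivWithin (hUτ t (hsub ht'))
  have hvd2 : ∀ t ∈ Ioo a τ, derivWithin v (Icc 0 τ) t = 0 := by
    intro t ht
    rw [derivWithin_of_mem_nhds (Icc_mem_nhds (ha0.trans ht.1) ht.2)]
    refine HasDerivAt.deriv ((hasDerivAt_const t (0:E)).congr_of_eventuallyEq ?_)
    filter_upwards [Icc_mem_nhds ht.1 ht.2] with x hx
    exact hv2 hx
  have hv0 : v 0 = u 0 := hv1 ⟨le_rfl, ha0.le⟩
  have hC1 : ContDiffOn ℝ 2 v (Icc 0 a) := hu.congr hv1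
  have hC2 : ContDiffOn ℝ 2 v (Icc a τ) := contDiffOn_const.congr hv2
  refine ⟨v, ⟨⟨?_, ?_⟩, ?_, ?_, ?_⟩, ⟨t₁, hsub ht₁, by rwa [hv1 ht₁]⟩, ?_⟩
  · rw [← Icc_union_Icc_eq_Icc ha0.le haτ]
    exact hC1.continuousOn.union_of_isClosed hC2.continuousOn isClosed_Icc isClosed_Icc
  · rcases eq_or_lt_of_le haτ with h | h
    · refine ⟨1, ![0, τ], ?_, rfl, rfl, ?_⟩
      · rw [Fin.strictMono_iff_lt_succ]
        intro i; fin_cases i; simpa using hτ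
      · intro i
        fin_cases i
        subst h
        simpa using hC1
    · refine ⟨2, ![0, a, τ], ?_, rfl, rfl, ?_⟩
      · rw [Fin.strictMono_iff_lt_succ]
        intro i; fin_cases i
        · simpa using ha0
        · simpa using h
      · intro i
        fin_cases i
        · simpa using hC1
        · simpa using hC2
  · rw [hv0]; exact hu0
  · intro w hw
    rw [hvd 0 ⟨le_rfl, ha0⟩, hv0, hu1 w hw]
  · exact hv2 ⟨haτ, le_rfl⟩
  · have huc := hu.continuousOn
    have hu'c := hu'C.continuousOn
    have hgc : ContinuousOn (fun t => ⟪u' t, u' t⟫ - ⟪R t (u t), u t⟫) (Icc 0 a) :=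
      (hu'c.inner hu'c).sub (((hRcont.mono hsub).clm_apply huc).inner huc)
    have hgi := hgc.intervalIntegrable_of_Icc (μ := volume) ha0.le
    let g : ℝ → ℝ := fun t => ⟪derivWithin v (Icc 0 τ) t, derivWithin v (Icc 0 τ) t⟫ - ⟪R t (v t), v t⟫
    have e1 : EqOn (fun t => ⟪u' t, u' t⟫ - ⟪R t (u t), u t⟫) g (Ioo 0 a) := by
      intro t ht
      simp only [g]
      rw [hvd t ⟨ht.1.le, ht.2⟩, hv1 ⟨ht.1.le, ht.2.le⟩]
    have e2 : EqOn (fun t => (0:ℝ)) g (Ioo a τ) := by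
      intro t ht
      simp only [g]
      rw [hvd2 t ht, hv2 ⟨ht.1.le, ht.2.le⟩]
      simp
    have i1 : IntervalIntegrable g volume 0 a := by
      rw [intervalIntegrable_iff_integrableOn_Ioo_of_le ha0.le] at hgi ⊢
      exact hgi.congr_fun e1 measurableSet_Ioo
    have i2 : IntervalIntegrable g volume a τ := by
      rw [intervalIntegrable_iff_integrableOn_Ioo_of_le haτ]
      exact IntegrableOn.congr_fun integrableOn_zero e2 measurableSet_Ioo
    have h3 : ∫ t in (0:ℝ)..a, (⟪u' t, u' t⟫ - ⟪R t (u t), u t⟫) = ⟪u' a, u a⟫ - ⟪u' 0, u 0⟫ := by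
      refine intervalIntegral.integral_eq_sub_of_hasDerivAt_of_le ha0.le (f := fun t => ⟪u' t, u t⟫)
        (hu'c.inner huc) ?_ hgi
      intro t ht
      have hn := Icc_mem_nhds ht.1 ht.2
      have ht' := Ioo_subset_Icc_self ht
      refine HasDerivAt.congr_deriv
        (((hd2 t ht').hasDerivAt hn).inner ℝ ((hd1 t ht').hasDerivAt hn)) ?_
      rw [inner_neg_left]; ring
    have h4 : indexForm R Q τ v = -(Q (v 0) (v 0)) + ∫ t in (0:ℝ)..τ, g t := rfl
    rw [h4, ← intervalIntegral.integral_add_adjacent_intervals i1 i2,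
      ← intervalIntegral.integral_congr_Ioo_of_le ha0.le e1,
      ← intervalIntegral.integral_congr_Ioo_of_le haτ e2, h3, hua, hu1 _ hu0, hv0]
    simp

end Forward

/-- **(Hermann, Corollary of Lemma 31.8.)** The interval `[0,τ]` contains no focal
points for `J = d²/dt² + R_t` and boundary condition `(E₀, Q)` if and only if
`I(u) > 0` for every `u ∈ Ω([0,τ],E)` not identically zero. -/
theorem no_focal_points_iff_indexForm_pos
    {E : Type*} [NormedAddCommGroup E] [InnerProductSpace ℝ E] [FiniteDimensional ℝ E]
    (τ : ℝ) (hτ : 0 < τ)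
    (R : ℝ → E →L[ℝ] E) (hRcont : ContinuousOn R (Set.Icc 0 τ))
    (hRsa : ∀ t ∈ Set.Icc (0:ℝ) τ, ∀ u v : E, ⟪R t u, v⟫ = ⟪u, R t v⟫)
    (E₀ : Submodule ℝ E) (Q : E →ₗ[ℝ] E →ₗ[ℝ] ℝ)
    (hQsymm : ∀ x ∈ E₀, ∀ y ∈ E₀, Q x y = Q y x) :
    (∀ a : ℝ, ¬ IsFocalPoint R E₀ Q τ a) ↔
      ∀ u : ℝ → E, InOmega E₀ Q τ u → (∃ t ∈ Set.Icc (0:ℝ) τ, u t ≠ 0) →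
        0 < indexForm R Q τ u := by
  constructor
  · intro hno u hu hne
    exact indexForm_pos τ hτ R hRcont hRsa E₀ Q hQsymm hno u hu hne
  · intro hpos a ha
    obtain ⟨v, hv, hne, h0⟩ := not_pos_of_focal τ hτ R hRcont E₀ Q a ha
    exact absurd (hpos v hv hne) (by rw [h0]; exact lt_irrefl _)
end

section
/- Let E be a finite-dimensional real inner product space, E₀ ⊆ E a subspace, Q a symmetric bilinear form on E₀, τ > 0, and t ↦ R_t a continuous family of self-adjoint operators on E. If t₀ ∈ (0,τ] is a focal point for the operator J = d²/dt² + R_t and boundary condition (E₀, Q), then there exists ε > 0 such that the set [t₀-ε, t₀+ε] ∩ (0,τ] contains no focal point other than t₀. Consequently, the interval [0,τ] contains only a finite number of focal points for J and (E₀, Q). -/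
open scoped RealInnerProductSpace

variable {E : Type*} [NormedAddCommGroup E] [InnerProductSpace ℝ E]

open Set Filter Topology NNReal

theorem lin_local {G : Type*} [NormedAddCommGroup G] [NormedSpace ℝ G] [CompleteSpace G]
    (A : ℝ → G →L[ℝ] G) (hA : Continuous A) (K : ℝ≥0) (hK : 0 < K) (hAK : ∀ t, ‖A t‖ ≤ K)
    (t₁ : ℝ) (x : G) (h : ℝ) (hh0 : 0 < h) (hh : 2 * (K : ℝ) * h = 1) :
    ∃ X : ℝ → G, X t₁ = x ∧ ∀ t ∈ Icc t₁ (t₁ + h),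
      HasDerivWithinAt X (A t (X t)) (Icc t₁ (t₁ + h)) t := by
  have hmem : t₁ ∈ Icc t₁ (t₁ + h) := ⟨le_rfl, by linarith⟩
  have hPL : IsPicardLindelof (fun t y => A t y) (⟨t₁, hmem⟩ : Icc t₁ (t₁ + h)) x ‖x‖₊ 0
      (2 * K * ‖x‖₊) K := by
    constructor
    · intro t _
      refine LipschitzWith.lipschitzOnWith ?_
      exact (A t).lipschitz.weaken (by exact_mod_cast hAK t)
    · intro y _
      fun_prop
    · intro t _ y hy
      have h1 : ‖y‖ ≤ 2 * ‖x‖ := by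
        have := norm_le_norm_add_norm_sub' y x
        rw [mem_closedBall_iff_norm] at hy
        simp at hy
        linarith
      have h2 := (A t).le_opNorm y
      have h3 : ‖A t‖ * ‖y‖ ≤ K * (2 * ‖x‖) := by gcongr; exact hAK t
      push_cast
      simp
      linarith
    · simp
      rw [max_eq_left hh0.le]
      have : 2 * (K : ℝ) * ‖x‖ * h = ‖x‖ := by rw [mul_right_comm, hh, one_mul]
      exact this.le
  exact hPL.exists_eq_forall_mem_Icc_hasDerivWithinAt₀

theorem lin_global {G : Type*} [NormedAddCommGroup G] [NormedSpace ℝ G] [CompleteSpace G]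
    (A : ℝ → G →L[ℝ] G) (hA : Continuous A) (K : ℝ≥0) (hK : 0 < K) (hAK : ∀ t, ‖A t‖ ≤ K)
    (x : G) (T : ℝ) :
    ∃ X : ℝ → G, X 0 = x ∧ ∀ t ∈ Icc 0 T,
      HasDerivWithinAt X (A t (X t)) (Icc 0 T) t := by
  have hK' : (0:ℝ) < K := hK
  set h : ℝ := 1 / (2 * K) with hh
  have hh0 : 0 < h := by positivity
  have hhK : 2 * (K : ℝ) * h = 1 := by rw [hh]; field_simp
  have key : ∀ n : ℕ, ∃ X : ℝ → G, X 0 = x ∧ ∀ t ∈ Icc 0 (n * h),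
      HasDerivWithinAt X (A t (X t)) (Icc 0 (n * h)) t := by
    intro n
    induction n with
    | zero =>
      refine ⟨fun _ => x, rfl, ?_⟩
      intro t ht
      simp only [CharP.cast_eq_zero, zero_mul, Icc_self, mem_singleton_iff] at ht ⊢
      subst ht
      rw [hasDerivWithinAt_iff_hasFDerivWithinAt]
      exact HasFDerivWithinAt.of_subsingleton (by simp)
    | succ n ih =>
      obtain ⟨X, hX0, hX⟩ := ih
      obtain ⟨Y, hY0, hY⟩ := lin_local A hA K hK hAK (n * h) (X (n * h)) h hh0 hhK
      have hn : 0 ≤ n * h := by positivity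
      set b := n * h with hb
      have hb' : ((n + 1 : ℕ) : ℝ) * h = b + h := by push_cast; ring
      rw [hb']
      have hZX : ∀ t ≤ b, (fun t => if t ≤ b then X t else Y t) t = X t := by
        intro t ht; simp [ht]
      have hZY : ∀ t, b ≤ t → (fun t => if t ≤ b then X t else Y t) t = Y t := by
        intro t ht
        rcases eq_or_lt_of_le ht with h1 | h1
        · subst h1; simp [hY0]
        · simp [not_le.2 h1]
      generalize (fun t => if t ≤ b then X t else Y t) = Z at hZX hZY
      refine ⟨Z, by rw [hZX 0 hn, hX0], ?_⟩
      intro t ht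
      rw [← Icc_union_Icc_eq_Icc hn (by linarith : b ≤ b + h)]
      refine HasDerivWithinAt.union ?_ ?_
      · by_cases htb : t ≤ b
        · rw [hZX t htb]
          exact (hX t ⟨ht.1, htb⟩).congr (fun s hs => hZX s hs.2) (hZX t htb)
        · rw [hasDerivWithinAt_iff_hasFDerivWithinAt]
          refine HasFDerivWithinAt.of_notMem_closure ?_
          rw [isClosed_Icc.closure_eq]
          exact fun h' => htb h'.2
      · by_cases htb : b ≤ t
        · rw [hZY t htb]
          exact (hY t ⟨htb, ht.2⟩).congr (fun s hs => hZY s hs.1) (hZY t htb)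
        · rw [hasDerivWithinAt_iff_hasFDerivWithinAt]
          refine HasFDerivWithinAt.of_notMem_closure ?_
          rw [isClosed_Icc.closure_eq]
          exact fun h' => htb h'.1
  obtain ⟨n, hn⟩ := exists_nat_ge (T / h)
  obtain ⟨X, hX0, hX⟩ := key n
  have hT : T ≤ n * h := by rwa [div_le_iff₀ hh0] at hn
  exact ⟨X, hX0, fun t ht => (hX t ⟨ht.1, ht.2.trans hT⟩).mono (Icc_subset_Icc_right hT)⟩

theorem icc_ici {G : Type*} [NormedAddCommGroup G] [NormedSpace ℝ G] {f : ℝ → G} {f' : G}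
    {a b t : ℝ} (ht : t ∈ Ico a b) (h : HasDerivWithinAt f f' (Icc a b) t) :
    HasDerivWithinAt f f' (Ici t) t :=
  h.mono_of_mem_nhdsWithin (Icc_mem_nhdsGE_of_mem ht)

theorem icc_iic {G : Type*} [NormedAddCommGroup G] [NormedSpace ℝ G] {f : ℝ → G} {f' : G}
    {a b t : ℝ} (ht : t ∈ Ioc a b) (h : HasDerivWithinAt f f' (Icc a b) t) :
    HasDerivWithinAt f f' (Iic t) t :=
  h.mono_of_mem_nhdsWithin (Icc_mem_nhdsLE_of_mem ht)

theorem lin_unique_right {G : Type*} [NormedAddCommGroup G] [NormedSpace ℝ G]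
    (A : ℝ → G →L[ℝ] G) (K : ℝ≥0) (hAK : ∀ t, ‖A t‖ ≤ K) (X Y : ℝ → G) (a b : ℝ)
    (hX : ∀ t ∈ Icc a b, HasDerivWithinAt X (A t (X t)) (Icc a b) t)
    (hY : ∀ t ∈ Icc a b, HasDerivWithinAt Y (A t (Y t)) (Icc a b) t)
    (h : X a = Y a) : EqOn X Y (Icc a b) := by
  refine ODE_solution_unique_of_mem_Icc_right (v := fun t y => A t y) (s := fun _ => univ) (K := K)
    ?_ (fun t ht => (hX t ht).continuousWithinAt)
    (fun t ht => icc_ici ht (hX t (Ico_subset_Icc_self ht))) (fun _ _ => mem_univ _)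
    (fun t ht => (hY t ht).continuousWithinAt)
    (fun t ht => icc_ici ht (hY t (Ico_subset_Icc_self ht))) (fun _ _ => mem_univ _) h
  intro t _
  exact ((A t).lipschitz.weaken (by exact_mod_cast hAK t)).lipschitzOnWith

theorem lin_unique_left {G : Type*} [NormedAddCommGroup G] [NormedSpace ℝ G]
    (A : ℝ → G →L[ℝ] G) (K : ℝ≥0) (hAK : ∀ t, ‖A t‖ ≤ K) (X Y : ℝ → G) (a b : ℝ)
    (hX : ∀ t ∈ Icc a b, HasDerivWithinAt X (A t (X t)) (Icc a b) t)
    (hY : ∀ t ∈ Icc a b, HasDerivWithinAt Y (A t (Y t)) (Icc a b) t)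
    (h : X b = Y b) : EqOn X Y (Icc a b) := by
  refine ODE_solution_unique_of_mem_Icc_left (v := fun t y => A t y) (s := fun _ => univ) (K := K)
    ?_ (fun t ht => (hX t ht).continuousWithinAt)
    (fun t ht => icc_iic ht (hX t (Ioc_subset_Icc_self ht))) (fun _ _ => mem_univ _)
    (fun t ht => (hY t ht).continuousWithinAt)
    (fun t ht => icc_iic ht (hY t (Ioc_subset_Icc_self ht))) (fun _ _ => mem_univ _) h
  intro t _
  exact ((A t).lipschitz.weaken (by exact_mod_cast hAK t)).lipschitzOnWith

theorem lin_flow {F : Type*} [NormedAddCommGroup F] [NormedSpace ℝ F] [CompleteSpace F]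
    (A : ℝ → F →L[ℝ] F) (hA : Continuous A) (K : ℝ≥0) (hK : 0 < K) (hAK : ∀ t, ‖A t‖ ≤ K)
    (T : ℝ) :
    ∃ Φ : ℝ → F →L[ℝ] F, Φ 0 = ContinuousLinearMap.id ℝ F ∧ ∀ t ∈ Icc 0 T,
      HasDerivWithinAt Φ ((A t).comp (Φ t)) (Icc 0 T) t := by
  have hb : ∀ t, ‖ContinuousLinearMap.compL ℝ F F F (A t)‖ ≤ K := by
    intro t
    refine ContinuousLinearMap.opNorm_le_bound _ K.2 (fun y => ?_)
    refine (ContinuousLinearMap.opNorm_comp_le _ _).trans ?_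
    gcongr
    exact hAK t
  obtain ⟨X, h0, hX⟩ := lin_global (fun t => ContinuousLinearMap.compL ℝ F F F (A t))
    (by fun_prop) K hK hb (ContinuousLinearMap.id ℝ F) T
  exact ⟨X, h0, hX⟩

/-- The coefficient operator of the first order system. -/
noncomputable def sysOp {E : Type*} [NormedAddCommGroup E] [InnerProductSpace ℝ E]
    (B : E →L[ℝ] E) : (E × E) →L[ℝ] (E × E) :=
  (ContinuousLinearMap.snd ℝ E E).prod (-(B.comp (ContinuousLinearMap.fst ℝ E E)))

theorem sysOp_apply {E : Type*} [NormedAddCommGroup E] [InnerProductSpace ℝ E]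
    (B : E →L[ℝ] E) (z : E × E) : sysOp B z = (z.2, -(B z.1)) := rfl

theorem sysOp_continuous {E : Type*} [NormedAddCommGroup E] [InnerProductSpace ℝ E]
    (R : ℝ → E →L[ℝ] E) (hR : Continuous R) : Continuous (fun t => sysOp (R t)) := by
  have : ∀ t, sysOp (R t) = (ContinuousLinearMap.inl ℝ E E).comp (ContinuousLinearMap.snd ℝ E E)
      - (ContinuousLinearMap.inr ℝ E E).comp ((R t).comp (ContinuousLinearMap.fst ℝ E E)) := by
    intro t; ext z <;> simp [sysOp_apply]
  simp only [this]
  fun_prop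

/-- data satisfying the boundary condition -/
def bdryData {E : Type*} [NormedAddCommGroup E] [InnerProductSpace ℝ E]
    (E₀ : Submodule ℝ E) (Q : E →ₗ[ℝ] E →ₗ[ℝ] ℝ) : Set (E × E) :=
  {z | z.1 ∈ E₀ ∧ ∀ w ∈ E₀, ⟪z.2, w⟫ = -(Q z.1 w)}

theorem bdryData_closed {E : Type*} [NormedAddCommGroup E] [InnerProductSpace ℝ E]
    [FiniteDimensional ℝ E]
    (E₀ : Submodule ℝ E) (Q : E →ₗ[ℝ] E →ₗ[ℝ] ℝ) : IsClosed (bdryData E₀ Q) := by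
  have h1 : IsClosed {z : E × E | z.1 ∈ E₀} :=
    (Submodule.closed_of_finiteDimensional E₀).preimage continuous_fst
  have h2 : IsClosed {z : E × E | ∀ w ∈ E₀, ⟪z.2, w⟫ = -(Q z.1 w)} := by
    simp only [Set.ofPred_forall]
    refine isClosed_iInter fun w => isClosed_iInter fun _ => ?_
    have hQ : Continuous fun x => Q x w := (Q.flip w).continuous_of_finiteDimensional
    exact isClosed_eq (by fun_prop) (hQ.comp continuous_fst).neg
  exact h1.inter h2

theorem bdryData_smul {E : Type*} [NormedAddCommGroup E] [InnerProductSpace ℝ E]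
    (E₀ : Submodule ℝ E) (Q : E →ₗ[ℝ] E →ₗ[ℝ] ℝ) (c : ℝ) (z : E × E) (hz : z ∈ bdryData E₀ Q) :
    c • z ∈ bdryData E₀ Q := by
  refine ⟨E₀.smul_mem c hz.1, fun w hw => ?_⟩
  have := hz.2 w hw
  simp [inner_smul_left, this]

theorem der_fst {E : Type*} [NormedAddCommGroup E] [InnerProductSpace ℝ E] {f : ℝ → E × E}
    {f' : E × E} {S : Set ℝ} {t : ℝ} (h : HasDerivWithinAt f f' S t) :
    HasDerivWithinAt (fun r => (f r).1) f'.1 S t :=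
  (ContinuousLinearMap.fst ℝ E E).hasFDerivAt.comp_hasDerivWithinAt t h

theorem der_snd {E : Type*} [NormedAddCommGroup E] [InnerProductSpace ℝ E] {f : ℝ → E × E}
    {f' : E × E} {S : Set ℝ} {t : ℝ} (h : HasDerivWithinAt f f' S t) :
    HasDerivWithinAt (fun r => (f r).2) f'.2 S t :=
  (ContinuousLinearMap.snd ℝ E E).hasFDerivAt.comp_hasDerivWithinAt t h

/-- Core compactness argument. -/
theorem core {E : Type*} [NormedAddCommGroup E] [InnerProductSpace ℝ E] [FiniteDimensional ℝ E]
    (τ : ℝ) (hτ : 0 < τ)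
    (R : ℝ → E →L[ℝ] E) (hRcont : ContinuousOn R (Set.Icc 0 τ))
    (hRsa : ∀ t ∈ Set.Icc (0:ℝ) τ, ∀ u v : E, ⟪R t u, v⟫ = ⟪u, R t v⟫)
    (E₀ : Submodule ℝ E) (Q : E →ₗ[ℝ] E →ₗ[ℝ] ℝ)
    (hQsymm : ∀ x ∈ E₀, ∀ y ∈ E₀, Q x y = Q y x)
    (s : ℝ) (hs : s ∈ Icc 0 τ) : ¬ AccPt s (𝓟 {a : ℝ | IsFocalPoint R E₀ Q τ a}) := by
  intro hacc
  -- extension of the coefficients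
  obtain ⟨R', hR', hRR'⟩ : ∃ R' : ℝ → E →L[ℝ] E, Continuous R' ∧ ∀ t, ∃ t' ∈ Icc 0 τ, R' t = R t' ∧
      (t ∈ Icc 0 τ → t' = t) := by
    refine ⟨fun t => R (projIcc 0 τ hτ.le t), ?_, fun t => ⟨_, (projIcc 0 τ hτ.le t).2, rfl, ?_⟩⟩
    · exact hRcont.comp_continuous (by fun_prop) (fun t => (projIcc 0 τ hτ.le t).2)
    · intro ht; rw [projIcc_of_mem hτ.le ht]
  have hReq : ∀ t ∈ Icc 0 τ, R' t = R t := by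
    intro t ht
    obtain ⟨t', _, h1, h2⟩ := hRR' t
    rw [h1, h2 ht]
  set A : ℝ → (E × E) →L[ℝ] (E × E) := fun t => sysOp (R' t) with hAdef
  have hA : Continuous A := sysOp_continuous R' hR'
  obtain ⟨K, hK, hAK⟩ : ∃ K : ℝ≥0, 0 < K ∧ ∀ t, ‖A t‖ ≤ K := by
    obtain ⟨C, hC⟩ := (isCompact_Icc (a := (0:ℝ)) (b := τ)).exists_bound_of_continuousOn
      (f := A) hA.continuousOn
    refine ⟨Real.toNNReal C + 1, by positivity, fun t => ?_⟩
    obtain ⟨t', ht', h1, h2⟩ := hRR' t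
    have : A t = A t' := by simp only [hAdef]; rw [h1, hReq t' ht']
    rw [this]
    have := hC t' ht'
    have := Real.le_coe_toNNReal C
    push_cast
    linarith
  obtain ⟨Φ, hΦ0, hΦ⟩ := lin_flow A hA K hK hAK τ
  -- vector-valued solutions
  have hsol : ∀ ζ : E × E, ∀ t ∈ Icc 0 τ,
      HasDerivWithinAt (fun t => Φ t ζ) (A t (Φ t ζ)) (Icc 0 τ) t := by
    intro ζ t ht
    have := (hΦ t ht).clm_apply (hasDerivWithinAt_const t (Icc 0 τ) ζ)
    simpa using this
  have hΦc : ContinuousOn Φ (Icc 0 τ) := fun t ht => (hΦ t ht).continuousWithinAt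
  -- injectivity
  have hinj : ∀ t ∈ Icc 0 τ, ∀ ζ, Φ t ζ = 0 → ζ = 0 := by
    intro t ht ζ h0
    have := lin_unique_left A K hAK (fun t => Φ t ζ) (fun _ => 0) 0 t
      (fun r hr => (hsol ζ r ⟨hr.1, hr.2.trans ht.2⟩).mono (Icc_subset_Icc_right ht.2))
      (fun r hr => by simpa using hasDerivWithinAt_const r (Icc 0 t) (0 : E × E)) h0
    have := this (⟨le_rfl, ht.1⟩ : (0:ℝ) ∈ Icc 0 t)
    simpa [hΦ0] using this
  -- isotropy
  have hiso : ∀ ζ ∈ bdryData E₀ Q, ∀ ξ ∈ bdryData E₀ Q, ∀ t ∈ Icc 0 τ,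
      ⟪(Φ t ζ).1, (Φ t ξ).2⟫ = ⟪(Φ t ζ).2, (Φ t ξ).1⟫ := by
    intro ζ hζ ξ hξ t ht
    have hd : ∀ r ∈ Icc 0 τ, HasDerivWithinAt
        (fun t => ⟪(Φ t ζ).1, (Φ t ξ).2⟫ - ⟪(Φ t ζ).2, (Φ t ξ).1⟫) 0 (Icc 0 τ) r := by
      intro r hr
      have a1 := der_fst (hsol ζ r hr)
      have a2 := der_snd (hsol ζ r hr)
      have b1 := der_fst (hsol ξ r hr)
      have b2 := der_snd (hsol ξ r hr)
      have := (a1.inner ℝ b2).sub (a2.inner ℝ b1)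
      refine this.congr_deriv ?_
      simp only [hAdef, sysOp_apply, inner_neg_left, inner_neg_right]
      rw [hReq r hr, hRsa r hr]
      ring
    have := constant_of_has_deriv_right_zero (fun r hr => (hd r hr).continuousWithinAt)
      (fun r hr => icc_ici hr (hd r (Ico_subset_Icc_self hr))) t ht
    have e : ⟪ζ.1, ξ.2⟫ = ⟪ζ.2, ξ.1⟫ := by
      rw [hζ.2 _ hξ.1, real_inner_comm, hξ.2 _ hζ.1, hQsymm _ hζ.1 _ hξ.1]
    simp [hΦ0, e] at this
    linarith
  -- focal points give data
  have hfoc : ∀ a, IsFocalPoint R E₀ Q τ a →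
      ∃ ζ ∈ bdryData E₀ Q ∩ Metric.sphere 0 1, (Φ a ζ).1 = 0 := by
    rintro a ⟨ha, u, ⟨hu, hode, hu0, hbd, hua⟩, t, ht, hut⟩
    set I := Icc 0 a with hI
    have hIτ : I ⊆ Icc 0 τ := Icc_subset_Icc_right ha.2
    have hud : UniqueDiffOn ℝ I := uniqueDiffOn_Icc ha.1
    have hd1 : DifferentiableOn ℝ u I := hu.differentiableOn (by norm_num)
    have hd2 : DifferentiableOn ℝ (derivWithin u I) I :=
      (hu.derivWithin hud (m := 1) (by norm_num)).differentiableOn (by norm_num)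
    set ζ : E × E := (u 0, derivWithin u I 0) with hζ
    have hEq : EqOn (fun t => (u t, derivWithin u I t)) (fun t => Φ t ζ) I := by
      refine lin_unique_right A K hAK _ _ 0 a ?_
        (fun r hr => (hsol ζ r (hIτ hr)).mono hIτ) (by simp [hΦ0, hζ])
      intro r hr
      have := (hd1 r hr).hasDerivWithinAt.prodMk (hd2 r hr).hasDerivWithinAt
      refine this.congr_deriv ?_
      simp only [hAdef, sysOp_apply, hReq r (hIτ hr)]
      rw [eq_neg_of_add_eq_zero_left (hode r hr)]
    have hζ0 : ζ ≠ 0 := by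
      intro h0
      have := hEq ht
      simp [h0] at this
      exact hut this.1
    have hζb : ζ ∈ bdryData E₀ Q := ⟨hu0, hbd⟩
    refine ⟨‖ζ‖⁻¹ • ζ, ⟨bdryData_smul _ _ _ _ hζb, ?_⟩, ?_⟩
    · simp [norm_smul, hζ0]
    · have := hEq (⟨ha.1.le, le_rfl⟩ : a ∈ I)
      simp only at this
      rw [map_smul, ← this]
      simp [hua]
  -- sequence
  rw [accPt_principal_iff_clusterPt, ← mem_closure_iff_clusterPt, mem_closure_iff_seq_limit] at hacc
  obtain ⟨a, ha, hlim⟩ := hacc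
  choose ζ hζ hζ0 using fun n => hfoc (a n) (ha n).1
  have hcomp : IsCompact (bdryData E₀ Q ∩ Metric.sphere 0 1) :=
    (isCompact_sphere _ _).inter_left (bdryData_closed E₀ Q)
  obtain ⟨z, hz, φ, hφ, hζlim⟩ := hcomp.tendsto_subseq hζ
  have haI : ∀ n, a n ∈ Icc 0 τ := fun n => Ioc_subset_Icc_self (ha n).1.1
  have hlim' : Tendsto (fun n => a (φ n)) atTop (𝓝[Icc 0 τ \ {s}] s) := by
    refine tendsto_nhdsWithin_iff.2 ⟨hlim.comp hφ.tendsto_atTop, ?_⟩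
    exact Eventually.of_forall fun n => ⟨haI _, (ha _).2⟩
  have hΦlim : Tendsto (fun n => Φ (a (φ n))) atTop (𝓝 (Φ s)) :=
    (hΦc s hs).tendsto.comp (hlim'.mono_right (nhdsWithin_mono _ sdiff_subset))
  have hvlim : Tendsto (fun n => Φ (a (φ n)) (ζ (φ n))) atTop (𝓝 (Φ s z)) :=
    (isBoundedBilinearMap_apply.continuous.tendsto (Φ s, z)).comp (hΦlim.prodMk_nhds hζlim)
  have hs0 : (Φ s z).1 = 0 := by
    have h1 := (continuous_fst.tendsto _).comp hvlim
    refine tendsto_nhds_unique h1 ?_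
    simp only [Function.comp_def, hζ0]
    exact tendsto_const_nhds
  have hslope : Tendsto (fun n => slope (fun t => (Φ t z).1) s (a (φ n))) atTop (𝓝 (Φ s z).2) := by
    have := der_fst (hsol z s hs)
    rw [hasDerivWithinAt_iff_tendsto_slope] at this
    exact this.comp hlim'
  have hin : Tendsto (fun n => ⟪(Φ (a (φ n)) (ζ (φ n))).2,
      slope (fun t => (Φ t z).1) s (a (φ n))⟫) atTop (𝓝 ⟪(Φ s z).2, (Φ s z).2⟫) :=
    ((continuous_snd.tendsto _).comp hvlim).inner hslope
  have hzero : ∀ n, ⟪(Φ (a (φ n)) (ζ (φ n))).2,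
      slope (fun t => (Φ t z).1) s (a (φ n))⟫ = 0 := by
    intro n
    have := hiso _ (hζ (φ n)).1 z hz.1 (a (φ n)) (haI _)
    rw [hζ0, inner_zero_left] at this
    simp [slope_def_module, hs0, inner_smul_right, ← this]
  simp only [hzero] at hin
  have h2 : (Φ s z).2 = 0 := by
    have := tendsto_nhds_unique hin tendsto_const_nhds
    exact inner_self_eq_zero.1 this
  have hz0 := hinj s hs z (Prod.ext hs0 h2)
  have := hz.2
  simp [hz0] at this

/-- **(Hermann, Lemma 31.6.)** A focal point `t₀ ∈ (0,τ]` for `J = d²/dt² + R_t` and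
boundary condition `(E₀, Q)` is isolated: for small `ε > 0` the set
`[t₀-ε, t₀+ε] ∩ (0,τ]` contains no other focal point.  Consequently, `[0,τ]` contains
only finitely many focal points. -/
theorem focal_points_isolated_and_finite
    {E : Type*} [NormedAddCommGroup E] [InnerProductSpace ℝ E] [FiniteDimensional ℝ E]
    (τ : ℝ) (hτ : 0 < τ)
    (R : ℝ → E →L[ℝ] E) (hRcont : ContinuousOn R (Set.Icc 0 τ))
    (hRsa : ∀ t ∈ Set.Icc (0:ℝ) τ, ∀ u v : E, ⟪R t u, v⟫ = ⟪u, R t v⟫)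
    (E₀ : Submodule ℝ E) (Q : E →ₗ[ℝ] E →ₗ[ℝ] ℝ)
    (hQsymm : ∀ x ∈ E₀, ∀ y ∈ E₀, Q x y = Q y x)
    (t₀ : ℝ) (ht₀ : IsFocalPoint R E₀ Q τ t₀) :
    (∃ ε > (0:ℝ), ∀ t ∈ Set.Icc (t₀ - ε) (t₀ + ε) ∩ Set.Ioc (0:ℝ) τ,
      t ≠ t₀ → ¬ IsFocalPoint R E₀ Q τ t) ∧
    {a : ℝ | IsFocalPoint R E₀ Q τ a}.Finite := by
  have hcore := core τ hτ R hRcont hRsa E₀ Q hQsymm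
  constructor
  · have h := hcore t₀ (Ioc_subset_Icc_self ht₀.1)
    rw [accPt_iff_frequently, not_frequently] at h
    obtain ⟨ε, hε, hh⟩ := Metric.nhds_basis_closedBall.eventually_iff.1 h
    refine ⟨ε, hε, fun t ht hne hf => ?_⟩
    refine hh (x := t) ?_ ⟨hne, hf⟩
    rw [Real.closedBall_eq_Icc]
    exact ht.1
  · by_contra hinf
    obtain ⟨s, hs, hacc⟩ := Set.Infinite.exists_accPt_of_subset_isCompact hinf
      (isCompact_Icc (a := (0:ℝ)) (b := τ)) (fun a ha => Ioc_subset_Icc_self ha.1)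
    exact hcore s hs hacc
end

section
/- Let E be a finite-dimensional real inner product space, τ > 0, t ↦ R_t a continuous family of self-adjoint operators on E, and let a < b in [0,τ] be such that [a,b] contains no pair of mutually conjugate points. Suppose u, v : [a,b] → E are continuous curves such that u is piecewise C², v is C², v''(t) + R_t(v(t)) = 0 for all t ∈ [a,b], u(a) = v(a), and u(b) = v(b). Then ∫_a^b [⟨v'(t), v'(t)⟩ - ⟨R_t(v(t)), v(t)⟩] dt ≤ ∫_a^b [⟨u'(t), u'(t)⟩ - ⟨R_t(u(t)), u(t)⟩] dt, with equality only if u(t) = v(t) for all t ∈ [a,b]. -/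
open scoped RealInnerProductSpace

variable {E : Type*} [NormedAddCommGroup E] [InnerProductSpace ℝ E]

open Set Filter Topology in
theorem aux_linear_ode {F : Type*} [NormedAddCommGroup F] [NormedSpace ℝ F] [FiniteDimensional ℝ F]
    (M : ℝ → F →L[ℝ] F) (a b : ℝ) (hab : a < b) (hM : ContinuousOn M (Icc a b)) (y₀ : F) :
    ∃ y : ℝ → F, y a = y₀ ∧ ∀ t ∈ Icc a b, HasDerivWithinAt y (M t (y t)) (Icc a b) t := by
  obtain ⟨C, hC⟩ := isCompact_Icc.exists_bound_of_continuousOn hM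
  have hC0 : 0 ≤ C := (norm_nonneg _).trans (hC a (left_mem_Icc.2 hab.le))
  set ρ : ℝ := ‖y₀‖ * Real.exp (C * (b - a)) + 1 with hρ
  have hρ0 : 0 < ρ := by positivity
  let φ : ContDiffBump (0 : F) := ⟨ρ, ρ + 1, hρ0, by linarith⟩
  let P : F → F := fun y => φ y • y
  have hPs : ContDiff ℝ 1 P := φ.contDiff.smul contDiff_id
  have hPc : HasCompactSupport P := φ.hasCompactSupport.smul_right
  obtain ⟨K, hK⟩ := hPs.lipschitzWith_of_hasCompactSupport hPc one_ne_zero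
  have hPle : ∀ y, ‖P y‖ ≤ ‖y‖ := fun y => by
    simp only [P, norm_smul, Real.norm_eq_abs, abs_of_nonneg (φ.nonneg)]
    exact mul_le_of_le_one_left (norm_nonneg _) φ.le_one
  have hPb : ∀ y, ‖P y‖ ≤ ρ + 1 := fun y => by
    by_cases h : ‖y‖ ≤ ρ + 1
    · exact (hPle y).trans h
    · have : φ y = 0 := φ.zero_of_le_dist (by simp [φ]; linarith)
      simp [P, this]; linarith
  have hP1 : ∀ y, ‖y‖ ≤ ρ → P y = y := fun y hy => by
    have : φ y = 1 := φ.one_of_mem_closedBall (by simpa [φ] using hy)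
    simp [P, this]
  obtain ⟨L, hL⟩ : ∃ L : NNReal, (L : ℝ) = C * (ρ + 1) := ⟨⟨C * (ρ + 1), by positivity⟩, rfl⟩
  obtain ⟨T, hT⟩ : ∃ T : NNReal, (T : ℝ) = b - a := ⟨⟨b - a, by linarith⟩, rfl⟩
  obtain ⟨C', hC'⟩ : ∃ T : NNReal, (T : ℝ) = C := ⟨⟨C, hC0⟩, rfl⟩
  have hPL : IsPicardLindelof (fun t y => M t (P y)) (⟨a, left_mem_Icc.2 hab.le⟩ : Icc a b) y₀
      (L * T) 0 L (C' * K) := by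
    refine ⟨fun t ht => ?_, fun x hx => ?_, fun t ht x hx => ?_, ?_⟩
    · have h1 : LipschitzWith C' (M t) := (M t).lipschitz.weaken (by
        rw [← NNReal.coe_le_coe, hC']; exact hC t ht)
      exact (h1.comp hK).lipschitzOnWith
    · exact hM.clm_apply continuousOn_const
    · refine ((M t).le_opNorm _).trans ?_
      rw [hL]
      exact mul_le_mul (hC t ht) (hPb x) (norm_nonneg _) hC0
    · have : max (b - a) (a - a) = b - a := max_eq_left (by linarith)
      rw [this]; simp [hT]
  obtain ⟨y, hy0, hy⟩ := hPL.exists_eq_forall_mem_Icc_hasDerivWithinAt₀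
  simp only at hy0
  have hbound := norm_le_gronwallBound_of_norm_deriv_right_le (f := y)
    (f' := fun t => M t (P (y t))) (δ := ‖y₀‖) (K := C) (ε := 0) (a := a) (b := b)
    (fun t ht => (hy t ht).continuousWithinAt)
    (fun t ht => ((hy t (Ico_subset_Icc_self ht)).mono_of_mem_nhdsWithin
      (Icc_mem_nhdsGE_of_mem ht)))
    (by rw [hy0]) (fun t ht => by
      rw [add_zero]
      refine ((M t).le_opNorm _).trans ?_
      exact mul_le_mul (hC t (Ico_subset_Icc_self ht)) (hPle _) (norm_nonneg _) hC0)
  refine ⟨y, hy0, fun t ht => ?_⟩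
  have h1 := hy t ht
  have h2 := hbound t ht
  rw [gronwallBound_ε0] at h2
  rwa [hP1 (y t)] at h1
  refine h2.trans ?_
  have : Real.exp (C * (t - a)) ≤ Real.exp (C * (b - a)) := by
    apply Real.exp_le_exp.2
    exact mul_le_mul_of_nonneg_left (by linarith [ht.2]) hC0
  have := mul_le_mul_of_nonneg_left this (norm_nonneg y₀)
  linarith

open Set Filter Topology in
theorem aux_jacobi {E : Type*} [NormedAddCommGroup E] [InnerProductSpace ℝ E]
    [FiniteDimensional ℝ E] (R : ℝ → E →L[ℝ] E) (a b : ℝ) (hab : a < b)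
    (hR : ContinuousOn R (Icc a b)) :
    ∃ A D : ℝ → E →L[ℝ] E, A a = 0 ∧ D a = 1 ∧
      (∀ t ∈ Icc a b, HasDerivWithinAt A (D t) (Icc a b) t) ∧
      (∀ t ∈ Icc a b, HasDerivWithinAt D (-(R t * A t)) (Icc a b) t) := by
  let 𝔸 := E →L[ℝ] E
  let M : ℝ → (𝔸 × 𝔸) →L[ℝ] (𝔸 × 𝔸) := fun t =>
    (ContinuousLinearMap.snd ℝ 𝔸 𝔸).prod
      (-((ContinuousLinearMap.mul ℝ 𝔸 (R t)).comp (ContinuousLinearMap.fst ℝ 𝔸 𝔸)))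
  have hM : ContinuousOn M (Icc a b) := by
    have h2 : ContinuousOn (fun t => -((ContinuousLinearMap.mul ℝ 𝔸 (R t)).comp
        (ContinuousLinearMap.fst ℝ 𝔸 𝔸))) (Icc a b) := by
      refine ContinuousOn.neg ?_
      refine ContinuousOn.clm_comp ?_ continuousOn_const
      exact (ContinuousLinearMap.mul ℝ 𝔸).continuous.comp_continuousOn hR
    exact (ContinuousLinearMap.prodₗᵢ ℝ (𝕜 := ℝ) (E := 𝔸 × 𝔸) (F := 𝔸) (G := 𝔸)).continuous.comp_continuousOn
      (continuousOn_const.prodMk h2)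
  obtain ⟨y, hy0, hy⟩ := aux_linear_ode M a b hab hM ((0 : 𝔸), (1 : 𝔸))
  refine ⟨fun t => (y t).1, fun t => (y t).2, by simp [hy0], by simp [hy0], fun t ht => ?_, fun t ht => ?_⟩
  · exact (ContinuousLinearMap.fst ℝ 𝔸 𝔸).hasFDerivAt.comp_hasDerivWithinAt t (hy t ht)
  · exact (ContinuousLinearMap.snd ℝ 𝔸 𝔸).hasFDerivAt.comp_hasDerivWithinAt t (hy t ht)

open Set Filter Topology MeasureTheory in
theorem aux_piecewise {E : Type*} [NormedAddCommGroup E] [InnerProductSpace ℝ E]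
    (u : ℝ → E) (a b : ℝ) (hab : a < b) (hu : PiecewiseContDiffOn 2 u a b) :
    ∃ S : Set ℝ, S.Finite ∧ (∀ t ∈ Ioo a b \ S, ContDiffAt ℝ 2 u t) ∧
      IntervalIntegrable (fun t => ⟪derivWithin u (Icc a b) t, derivWithin u (Icc a b) t⟫)
        volume a b ∧ ∃ ξ, HasDerivWithinAt u ξ (Ioi a) a := by
  obtain ⟨huc, k, s, hs, hs0, hsk, hC⟩ := hu
  have hC' : ∀ i : Fin k, ContDiffOn ℝ 2 u (Icc (s i.castSucc) (s i.succ)) := fun i => by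
    have := hC i
    norm_cast at this
  have hk : 0 < k := by
    rcases Nat.eq_zero_or_pos k with h | h
    · subst h
      have : s 0 = s (Fin.last 0) := rfl
      rw [hs0, hsk] at this; linarith
    · exact h
  refine ⟨range s, finite_range s, ?_, ?_, ?_⟩
  · rintro t ⟨ht, htS⟩
    have hex : ∃ i : Fin k, s i.castSucc < t ∧ t < s i.succ := by
      by_contra! hcon
      have : ∀ i : Fin (k + 1), s i < t := by
        intro i
        induction i using Fin.induction with
        | zero => rw [hs0]; exact ht.1
        | succ i ih => 
          refine lt_of_le_of_ne (hcon i ih) ?_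
          intro h; exact htS ⟨_, h⟩
      have := this (Fin.last k)
      rw [hsk] at this; linarith [ht.2]
    obtain ⟨i, h1, h2⟩ := hex
    exact (hC' i).contDiffAt (Icc_mem_nhds h1 h2)
  · let σ : ℕ → ℝ := fun j => if h : j < k + 1 then s ⟨j, h⟩ else b
    have e0 : σ 0 = a := by simp only [σ]; rw [dif_pos (by omega)]; exact hs0
    have ek : σ k = b := by simp only [σ]; rw [dif_pos (by omega)]; exact hsk
    rw [← e0, ← ek]
    refine IntervalIntegrable.trans_iterate (fun j hj => ?_)
    have e1 : σ j = s (Fin.castSucc ⟨j, hj⟩) := by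
      simp only [σ]; rw [dif_pos (by omega)]; rfl
    have e2 : σ (j + 1) = s (Fin.succ ⟨j, hj⟩) := by
      simp only [σ]; rw [dif_pos (by omega)]; rfl
    rw [e0, ek, e1, e2]
    set i : Fin k := ⟨j, hj⟩
    have hlt : s i.castSucc < s i.succ := hs i.castSucc_lt_succ
    have hca : a ≤ s i.castSucc := by rw [← hs0]; exact hs.monotone (Fin.zero_le _)
    have hdb : s i.succ ≤ b := by rw [← hsk]; exact hs.monotone (Fin.le_last _)
    have hcont : ContinuousOn (derivWithin u (Icc (s i.castSucc) (s i.succ)))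
        (Icc (s i.castSucc) (s i.succ)) :=
      (hC' i).continuousOn_derivWithin (uniqueDiffOn_Icc hlt) (by norm_num)
    have hint : IntervalIntegrable (fun t => ⟪derivWithin u (Icc (s i.castSucc) (s i.succ)) t,
        derivWithin u (Icc (s i.castSucc) (s i.succ)) t⟫) volume (s i.castSucc) (s i.succ) := by
      apply ContinuousOn.intervalIntegrable
      rw [uIcc_of_le hlt.le]
      exact hcont.inner hcont
    refine hint.congr_uIoo ?_
    intro t ht
    rw [uIoo_of_le hlt.le] at ht
    have : derivWithin u (Icc (s i.castSucc) (s i.succ)) t = derivWithin u (Icc a b) t := by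
      rw [derivWithin_of_mem_nhds (Icc_mem_nhds ht.1 ht.2), derivWithin_of_mem_nhds
        (Icc_mem_nhds (hca.trans_lt ht.1) (ht.2.trans_le hdb))]
    simp only [this]
  · let i : Fin k := ⟨0, hk⟩
    have e1 : s i.castSucc = a := hs0
    have hlt : s i.castSucc < s i.succ := hs i.castSucc_lt_succ
    have h1 := ((hC' i).differentiableOn (by norm_num)) (s i.castSucc) (left_mem_Icc.2 hlt.le)
    rw [e1] at h1 hlt
    refine ⟨_, h1.hasDerivWithinAt.mono_of_mem_nhdsWithin ?_⟩
    exact Icc_mem_nhdsGT hlt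

open Set Filter Topology in
theorem aux_contDiff {E : Type*} [NormedAddCommGroup E] [InnerProductSpace ℝ E]
    (y y' y'' : ℝ → E) (a b : ℝ) (hab : a < b)
    (h1 : ∀ t ∈ Icc a b, HasDerivWithinAt y (y' t) (Icc a b) t)
    (h2 : ∀ t ∈ Icc a b, HasDerivWithinAt y' (y'' t) (Icc a b) t)
    (h3 : ContinuousOn y'' (Icc a b)) :
    ContDiffOn ℝ 2 y (Icc a b) ∧
      ∀ t ∈ Icc a b, derivWithin (derivWithin y (Icc a b)) (Icc a b) t = y'' t := by
  have hU := uniqueDiffOn_Icc hab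
  have e1 : ∀ t ∈ Icc a b, derivWithin y (Icc a b) t = y' t := fun t ht =>
    (h1 t ht).derivWithin (hU t ht)
  have e2 : ∀ t ∈ Icc a b, derivWithin y' (Icc a b) t = y'' t := fun t ht =>
    (h2 t ht).derivWithin (hU t ht)
  constructor
  · have : (2 : WithTop ℕ∞) = 1 + 1 := by norm_num
    rw [this, contDiffOn_succ_iff_derivWithin hU]
    refine ⟨fun t ht => (h1 t ht).differentiableWithinAt, by simp, ?_⟩
    refine ContDiffOn.congr ?_ e1
    have : (1 : WithTop ℕ∞) = 0 + 1 := by norm_num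
    rw [this, contDiffOn_succ_iff_derivWithin hU]
    refine ⟨fun t ht => (h2 t ht).differentiableWithinAt, by simp, ?_⟩
    rw [contDiffOn_zero]
    exact h3.congr e2
  · intro t ht
    rw [derivWithin_congr e1 (e1 t ht), e2 t ht]

open Set Filter Topology in
theorem aux_isUnit {E : Type*} [NormedAddCommGroup E] [InnerProductSpace ℝ E]
    [FiniteDimensional ℝ E] (R : ℝ → E →L[ℝ] E) (a b : ℝ)
    (hR : ContinuousOn R (Icc a b))
    (hconj : ∀ c ∈ Icc a b, ∀ d ∈ Icc a b, ¬ MutuallyConjugate R c d)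
    (A D : ℝ → E →L[ℝ] E) (hA0 : A a = 0) (hD0 : D a = 1)
    (hA : ∀ t ∈ Icc a b, HasDerivWithinAt A (D t) (Icc a b) t)
    (hD : ∀ t ∈ Icc a b, HasDerivWithinAt D (-(R t * A t)) (Icc a b) t)
    (t : ℝ) (ht : t ∈ Ioc a b) : IsUnit (A t) := by
  have hsub : Icc a t ⊆ Icc a b := Icc_subset_Icc_right ht.2
  have hinj : Function.Injective (A t) := by
    rw [injective_iff_map_eq_zero]
    intro e he
    by_contra hne
    have g1 : ∀ s ∈ Icc a t, HasDerivWithinAt (fun s => A s e) (D s e) (Icc a t) s := fun s hs => by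
      simpa using ((hA s (hsub hs)).mono hsub).clm_apply (hasDerivWithinAt_const s _ e)
    have g2 : ∀ s ∈ Icc a t, HasDerivWithinAt (fun s => D s e) (-(R s (A s e))) (Icc a t) s :=
      fun s hs => by
      simpa using ((hD s (hsub hs)).mono hsub).clm_apply (hasDerivWithinAt_const s _ e)
    have g3 : ContinuousOn (fun s => -(R s (A s e))) (Icc a t) :=
      ((hR.mono hsub).clm_apply (fun s hs => (g1 s hs).continuousWithinAt)).neg
    obtain ⟨k1, k2⟩ := aux_contDiff _ _ _ a t ht.1 g1 g2 g3
    refine hconj a ⟨le_rfl, ht.1.le.trans ht.2⟩ t ⟨ht.1.le, ht.2⟩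
      ⟨ht.1, fun s => A s e, k1, fun s hs => ?_, by simp [hA0], he, ?_⟩
    · rw [k2 s hs]; simp
    · by_contra! hz
      have ha : a ∈ Icc a t := left_mem_Icc.2 ht.1.le
      have h0 : HasDerivWithinAt (fun s => A s e) 0 (Icc a t) a :=
        (hasDerivWithinAt_const a _ (0:E)).congr hz (hz a ha)
      have := (uniqueDiffOn_Icc ht.1 a ha).eq_deriv _ (g1 a ha) h0
      rw [hD0] at this
      exact hne this
  rw [ContinuousLinearMap.isUnit_iff_bijective]
  exact ⟨hinj, (LinearMap.injective_iff_surjective (f := (A t : E →ₗ[ℝ] E))).1 hinj⟩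

open Set Filter Topology in
theorem aux_wronskian {E : Type*} [NormedAddCommGroup E] [InnerProductSpace ℝ E]
    (R : ℝ → E →L[ℝ] E) (a b : ℝ)
    (hRsa : ∀ t ∈ Icc a b, ∀ u v : E, ⟪R t u, v⟫ = ⟪u, R t v⟫)
    (A D : ℝ → E →L[ℝ] E) (hA0 : A a = 0)
    (hA : ∀ t ∈ Icc a b, HasDerivWithinAt A (D t) (Icc a b) t)
    (hD : ∀ t ∈ Icc a b, HasDerivWithinAt D (-(R t * A t)) (Icc a b) t)
    (t : ℝ) (ht : t ∈ Icc a b) (y z : E) : ⟪D t y, A t z⟫ = ⟪A t y, D t z⟫ := by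
  have g1 : ∀ e, ∀ s ∈ Icc a b, HasDerivWithinAt (fun s => A s e) (D s e) (Icc a b) s :=
    fun e s hs => by
      simpa using (hA s hs).clm_apply (hasDerivWithinAt_const s _ e)
  have g2 : ∀ e, ∀ s ∈ Icc a b, HasDerivWithinAt (fun s => D s e) (-(R s (A s e))) (Icc a b) s :=
    fun e s hs => by
      simpa using (hD s hs).clm_apply (hasDerivWithinAt_const s _ e)
  have g3 : ∀ s ∈ Icc a b, HasDerivWithinAt (fun s => ⟪D s y, A s z⟫ - ⟪A s y, D s z⟫) 0
      (Icc a b) s := by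
    intro s hs
    refine (((g2 y s hs).inner ℝ (g1 z s hs)).sub ((g1 y s hs).inner ℝ (g2 z s hs))).congr_deriv ?_
    simp only [inner_neg_left, inner_neg_right, hRsa s hs]
    ring
  have := constant_of_has_deriv_right_zero (a := a) (b := b)
    (fun s hs => (g3 s hs).continuousWithinAt) (fun s hs =>
      (g3 s (Ico_subset_Icc_self hs)).mono_of_mem_nhdsWithin (Icc_mem_nhdsGE_of_mem hs)) t ht
  simp only [hA0, zero_apply, inner_zero_left, inner_zero_right, sub_zero] at this
  linarith

open Set Filter Topology in
theorem aux_mono (f f' : ℝ → ℝ) (S : Set ℝ) (hS : S.Finite) : ∀ (a b : ℝ), a ≤ b →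
    ContinuousOn f (Icc a b) → (∀ t ∈ Ioo a b \ S, HasDerivAt f (f' t) t) →
    (∀ t ∈ Ioo a b \ S, 0 ≤ f' t) → f a ≤ f b := by
  induction S, hS using Set.Finite.induction_on with
  | empty =>
    intro a b hab hc hd hn
    refine monotoneOn_of_deriv_nonneg (convex_Icc a b) hc ?_ ?_ (left_mem_Icc.2 hab)
      (right_mem_Icc.2 hab) hab
    · intro t ht
      rw [interior_Icc] at ht
      exact (hd t ⟨ht, by simp⟩).differentiableAt.differentiableWithinAt
    · intro t ht
      rw [interior_Icc] at ht
      rw [(hd t ⟨ht, by simp⟩).deriv]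
      exact hn t ⟨ht, by simp⟩
  | @insert p S hp hS ih =>
    intro a b hab hc hd hn
    by_cases hpm : p ∈ Ioo a b
    · have s1 : Ioo a p \ S ⊆ Ioo a b \ insert p S := by
        rintro t ⟨ht, htS⟩
        refine ⟨⟨ht.1, ht.2.trans hpm.2⟩, ?_⟩
        rintro (h | h)
        · exact absurd h ht.2.ne
        · exact htS h
      have s2 : Ioo p b \ S ⊆ Ioo a b \ insert p S := by
        rintro t ⟨ht, htS⟩
        refine ⟨⟨hpm.1.trans ht.1, ht.2⟩, ?_⟩
        rintro (h | h)
        · exact absurd h ht.1.ne'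
        · exact htS h
      exact (ih a p hpm.1.le (hc.mono (Icc_subset_Icc_right hpm.2.le)) (fun t ht => hd t (s1 ht))
        (fun t ht => hn t (s1 ht))).trans
        (ih p b hpm.2.le (hc.mono (Icc_subset_Icc_left hpm.1.le)) (fun t ht => hd t (s2 ht))
        (fun t ht => hn t (s2 ht)))
    · have s1 : Ioo a b \ S ⊆ Ioo a b \ insert p S := by
        rintro t ⟨ht, htS⟩
        refine ⟨ht, ?_⟩
        rintro (h | h)
        · rw [h] at ht; exact hpm ht
        · exact htS h
      exact ih a b hab hc (fun t ht => hd t (s1 ht)) (fun t ht => hn t (s1 ht))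

open Filter Topology in
theorem aux_tendsto_apply {E : Type*} [NormedAddCommGroup E] [InnerProductSpace ℝ E]
    {l : Filter ℝ} {B : ℝ → E →L[ℝ] E} {B₀ : E →L[ℝ] E} {y : ℝ → E} {y₀ : E}
    (hB : Tendsto B l (𝓝 B₀)) (hy : Tendsto y l (𝓝 y₀)) :
    Tendsto (fun t => B t (y t)) l (𝓝 (B₀ y₀)) := by
  have h : Continuous (fun z : (E →L[ℝ] E) × E => z.1 z.2) := by fun_prop
  exact (h.tendsto (B₀, y₀)).comp (hB.prodMk_nhds hy)

open Set Filter Topology MeasureTheory in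
theorem aux_main {E : Type*} [NormedAddCommGroup E] [InnerProductSpace ℝ E]
    [FiniteDimensional ℝ E] (R : ℝ → E →L[ℝ] E) (a b : ℝ) (hab : a < b)
    (hR : ContinuousOn R (Icc a b))
    (hRsa : ∀ t ∈ Icc a b, ∀ u v : E, ⟪R t u, v⟫ = ⟪u, R t v⟫)
    (hconj : ∀ c ∈ Icc a b, ∀ d ∈ Icc a b, ¬ MutuallyConjugate R c d)
    (u v p q : ℝ → E)
    (S : Set ℝ) (hS : S.Finite)
    (huc : ContinuousOn u (Icc a b))
    (hud : ∀ t ∈ Ioo a b \ S, HasDerivAt u (p t) t)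
    (hpc : ∀ t ∈ Ioo a b \ S, ContinuousAt p t)
    (hpi : IntervalIntegrable (fun t => ⟪p t, p t⟫) volume a b)
    (ξ : E) (hξ : HasDerivWithinAt u ξ (Ioi a) a)
    (hv : ∀ t ∈ Icc a b, HasDerivWithinAt v (q t) (Icc a b) t)
    (hq : ∀ t ∈ Icc a b, HasDerivWithinAt q (-(R t (v t))) (Icc a b) t)
    (hua : u a = v a) (hub : u b = v b) :
    (∫ t in a..b, (⟪q t, q t⟫ - ⟪R t (v t), v t⟫)) ≤
      (∫ t in a..b, (⟪p t, p t⟫ - ⟪R t (u t), u t⟫)) ∧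
    ((∫ t in a..b, (⟪q t, q t⟫ - ⟪R t (v t), v t⟫)) =
      (∫ t in a..b, (⟪p t, p t⟫ - ⟪R t (u t), u t⟫)) → ∀ t ∈ Icc a b, u t = v t) := by
  obtain ⟨A, D, hA0, hD0, hA, hD⟩ := aux_jacobi R a b hab hR
  have hAu := aux_isUnit R a b hR hconj A D hA0 hD0 hA hD
  have hW := aux_wronskian R a b hRsa A D hA0 hA hD
  have hvc : ContinuousOn v (Icc a b) := fun t ht => (hv t ht).continuousWithinAt
  have hqc : ContinuousOn q (Icc a b) := fun t ht => (hq t ht).continuousWithinAt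
  have hAc : ContinuousOn A (Icc a b) := fun t ht => (hA t ht).continuousWithinAt
  have hDc : ContinuousOn D (Icc a b) := fun t ht => (hD t ht).continuousWithinAt
  set gu : ℝ → ℝ := fun t => ⟪p t, p t⟫ - ⟪R t (u t), u t⟫ with hgu
  set gv : ℝ → ℝ := fun t => ⟪q t, q t⟫ - ⟪R t (v t), v t⟫ with hgv
  have hRu : ContinuousOn (fun t => ⟪R t (u t), u t⟫) (Icc a b) := (hR.clm_apply huc).inner huc
  have hgvc : ContinuousOn gv (Icc a b) := (hqc.inner hqc).sub ((hR.clm_apply hvc).inner hvc)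
  have hgvi : IntervalIntegrable gv volume a b :=
    ContinuousOn.intervalIntegrable (by rwa [uIcc_of_le hab.le])
  have hgui : IntervalIntegrable gu volume a b :=
    hpi.sub (ContinuousOn.intervalIntegrable (by rwa [uIcc_of_le hab.le]))
  set h : ℝ → ℝ := fun t => gu t - gv t with hh
  have hhi : IntervalIntegrable h volume a b := hgui.sub hgvi
  have hint : ∫ t in a..b, h t = (∫ t in a..b, gu t) - ∫ t in a..b, gv t :=
    intervalIntegral.integral_sub hgui hgvi
  let U : Set ℝ := Ioo a b \ S
  have hUo : IsOpen U := isOpen_Ioo.sdiff hS.isClosed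
  have hUn : ∀ t ∈ U, Icc a b ∈ 𝓝 t := fun t ht => Icc_mem_nhds ht.1.1 ht.1.2
  have hhc : ∀ t ∈ U, ContinuousAt h t := fun t ht =>
    (((hpc t ht).inner (hpc t ht)).sub (hRu.continuousAt (hUn t ht))).sub
      (hgvc.continuousAt (hUn t ht))
  have hhm := ContinuousAt.stronglyMeasurableAtFilter (μ := volume) hUo hhc
  let w : ℝ → E := fun t => u t - v t
  have hwc : ContinuousOn w (Icc a b) := huc.sub hvc
  have hwa : w a = 0 := by simp [w, hua]
  have hwb : w b = 0 := by simp [w, hub]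
  let x : ℝ → E := fun t => Ring.inverse (A t) (w t)
  have hAx : ∀ t ∈ Ioc a b, A t (x t) = w t := fun t ht => by
    have := Ring.mul_inverse_cancel (A t) (hAu t ht)
    exact congrArg (fun B : E →L[ℝ] E => B (w t)) this
  have hxc : ContinuousOn x (Ioc a b) := by
    have : ContinuousOn (fun t => Ring.inverse (A t)) (Ioc a b) := fun t ht => by
      have h1 : ContinuousAt Ring.inverse (A t) := by
        obtain ⟨y, hy⟩ := hAu t ht
        rw [← hy]; exact NormedRing.inverse_continuousAt y
      exact h1.comp_continuousWithinAt ((hAc t (Ioc_subset_Icc_self ht)).mono Ioc_subset_Icc_self)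
    exact this.clm_apply (hwc.mono Ioc_subset_Icc_self)
  have hxd : ∀ t ∈ U, ∃ x', HasDerivAt x x' t ∧ p t - q t = D t (x t) + A t x' := by
    intro t ht
    have hAt := (hA t (mem_of_mem_nhds (hUn t ht))).hasDerivAt (hUn t ht)
    have hwt : HasDerivAt w (p t - q t) t := (hud t ht).sub
      ((hv t (mem_of_mem_nhds (hUn t ht))).hasDerivAt (hUn t ht))
    have h1 : DifferentiableAt ℝ (fun t => Ring.inverse (A t)) t :=
      (differentiableAt_inverse (𝕜 := ℝ) (hAu t ⟨ht.1.1, ht.1.2.le⟩)).comp t hAt.differentiableAt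
    have hx : DifferentiableAt ℝ x t := h1.clm_apply hwt.differentiableAt
    refine ⟨_, hx.hasDerivAt, ?_⟩
    have h2 := hAt.clm_apply hx.hasDerivAt
    have h3 : w =ᶠ[𝓝 t] fun s => A s (x s) := by
      filter_upwards [Ioo_mem_nhds ht.1.1 ht.1.2] with s hs
      exact (hAx s ⟨hs.1, hs.2.le⟩).symm
    exact hwt.unique (h2.congr_of_eventuallyEq h3)
  choose! x' hx' hpq using hxd
  let G : ℝ → ℝ := fun t => (∫ s in a..t, h s) - 2 * ⟪q t, w t⟫ - ⟪D t (x t), w t⟫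
  have hIc : ContinuousOn (fun t => ∫ s in a..t, h s) (Icc a b) := by
    have := intervalIntegral.continuousOn_primitive_interval' hhi left_mem_uIcc
    rwa [uIcc_of_le hab.le] at this
  have hGc : ContinuousOn G (Ioc a b) := by
    have hs : Ioc a b ⊆ Icc a b := Ioc_subset_Icc_self
    exact ((hIc.mono hs).sub (continuousOn_const.mul ((hqc.inner hwc).mono hs))).sub
      (((hDc.mono hs).clm_apply hxc).inner (hwc.mono hs))
  have hGd : ∀ t ∈ U, HasDerivAt G (⟪A t (x' t), A t (x' t)⟫) t := by
    intro t ht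
    have htI : t ∈ Icc a b := mem_of_mem_nhds (hUn t ht)
    have hi : IntervalIntegrable h volume a t := hhi.mono_set (by
      rw [uIcc_of_le hab.le, uIcc_of_le htI.1]; exact Icc_subset_Icc_right htI.2)
    have d1 := intervalIntegral.integral_hasDerivAt_right hi (hhm t ht) (hhc t ht)
    have dq := (hq t htI).hasDerivAt (hUn t ht)
    have hwt : HasDerivAt w (p t - q t) t := (hud t ht).sub ((hv t htI).hasDerivAt (hUn t ht))
    have dD := (hD t htI).hasDerivAt (hUn t ht)
    have d2 := (dq.inner ℝ hwt).const_mul 2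
    have d3 := (dD.clm_apply (hx' t ht)).inner ℝ hwt
    refine ((d1.sub d2).sub d3).congr_deriv ?_
    have eu : u t = v t + A t (x t) := by rw [hAx t ⟨ht.1.1, ht.1.2.le⟩]; simp [w]
    have ep : p t = q t + (D t (x t) + A t (x' t)) := by rw [← hpq t ht]; abel
    have ew : w t = A t (x t) := (hAx t ⟨ht.1.1, ht.1.2.le⟩).symm
    simp only [hh, hgu, hgv, ew, eu, ep]
    have hw1 := hW t htI (x' t) (x t)
    have hr := hRsa t htI (A t (x t)) (v t)
    have c1 := real_inner_comm (v t) (R t (A t (x t)))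
    have c2 := real_inner_comm (R t (v t)) (A t (x t))
    have c3 := real_inner_comm (A t (x' t)) (D t (x t))
    have c4 := real_inner_comm (q t) (D t (x t))
    have c5 := real_inner_comm (q t) (A t (x' t))
    have c6 := real_inner_comm (A t (x t)) (D t (x' t))
    simp only [map_add, inner_add_left, inner_add_right, inner_neg_left, add_sub_cancel_left,
      neg_apply, mul_apply_eq_comp]
    linarith
  have hGmono : ∀ c d, a < c → c ≤ d → d ≤ b → G c ≤ G d := by
    intro c d hc hcd hd
    have hs : Ioo c d \ S ⊆ U := fun t ht => ⟨⟨hc.trans ht.1.1, ht.1.2.trans_le hd⟩, ht.2⟩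
    exact aux_mono G _ S hS c d hcd (hGc.mono (fun t ht => ⟨hc.trans_le ht.1, ht.2.trans hd⟩))
      (fun t ht => hGd t (hs ht)) (fun t ht => real_inner_self_nonneg)
  have hnh : 𝓝[>] a ≤ 𝓝[Icc a b] a := nhdsWithin_le_of_mem (Icc_mem_nhdsGT hab)
  have haI : a ∈ Icc a b := left_mem_Icc.2 hab.le
  have hxl : ∃ η, Tendsto x (𝓝[>] a) (𝓝 η) := by
    have hwd : HasDerivWithinAt w (ξ - q a) (Ioi a) a :=
      hξ.sub ((hv a haI).mono_of_mem_nhdsWithin (Icc_mem_nhdsGT hab))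
    have hAd : HasDerivWithinAt A (D a) (Ioi a) a :=
      (hA a haI).mono_of_mem_nhdsWithin (Icc_mem_nhdsGT hab)
    rw [hasDerivWithinAt_iff_tendsto_slope' (by simp)] at hwd hAd
    rw [hD0] at hAd
    have h1 : Tendsto (fun t => Ring.inverse (slope A a t)) (𝓝[>] a)
        (𝓝 (Ring.inverse (1 : E →L[ℝ] E))) :=
      (NormedRing.inverse_continuousAt (1 : (E →L[ℝ] E)ˣ)).tendsto.comp hAd
    have h2 := aux_tendsto_apply h1 hwd
    refine ⟨_, h2.congr' ?_⟩
    filter_upwards [Ioc_mem_nhdsGT hab] with t ht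
    have hta : (t - a)⁻¹ ≠ 0 := inv_ne_zero (sub_pos.2 ht.1).ne'
    have hun : IsUnit (slope A a t) := by
      simp only [slope_def_module, hA0, sub_zero]
      exact (hAu t ht).smul (Units.mk0 _ hta)
    have : slope w a t = slope A a t (x t) := by
      simp only [slope_def_module, hA0, hwa, sub_zero, ContinuousLinearMap.smul_apply]
      rw [hAx t ht]
    rw [this]
    exact congrArg (fun B : E →L[ℝ] E => B (x t)) (Ring.inverse_mul_cancel _ hun)
  obtain ⟨η, hη⟩ := hxl
  have hG0 : Tendsto G (𝓝[>] a) (𝓝 0) := by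
    have l1 : Tendsto (fun t => ∫ s in a..t, h s) (𝓝[>] a) (𝓝 0) := by
      have := (hIc a haI).tendsto.mono_left hnh
      simpa using this
    have lw : Tendsto w (𝓝[>] a) (𝓝 0) := by
      have := (hwc a haI).tendsto.mono_left hnh
      rwa [hwa] at this
    have lq := (hqc a haI).tendsto.mono_left hnh
    have lD := (hDc a haI).tendsto.mono_left hnh
    have := (l1.sub ((lq.inner lw).const_mul 2)).sub ((aux_tendsto_apply lD hη).inner lw)
    simpa using this
  have hGnn : ∀ d ∈ Ioc a b, 0 ≤ G d := by
    intro d hd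
    refine le_of_tendsto hG0 ?_
    filter_upwards [Ioc_mem_nhdsGT hd.1] with c hc
    exact hGmono c d hc.1 hc.2 hd.2
  have hGb : G b = (∫ t in a..b, gu t) - ∫ t in a..b, gv t := by
    simp only [G, hwb, inner_zero_right, hint]; ring
  have hb' : b ∈ Ioc a b := ⟨hab, le_rfl⟩
  refine ⟨by linarith [hGnn b hb'], fun heq => ?_⟩
  have hGz : ∀ d ∈ Ioc a b, G d = 0 := fun d hd =>
    le_antisymm ((hGmono d b hd.1 hd.2 le_rfl).trans (by rw [hGb]; linarith)) (hGnn d hd)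
  have hx0 : ∀ t ∈ U, HasDerivAt x 0 t := by
    intro t ht
    have e : G =ᶠ[𝓝 t] fun _ => 0 := by
      filter_upwards [Ioo_mem_nhds ht.1.1 ht.1.2] with s hs
      exact hGz s ⟨hs.1, hs.2.le⟩
    have h1 := (hGd t ht).unique ((hasDerivAt_const t (0:ℝ)).congr_of_eventuallyEq e)
    rw [inner_self_eq_zero] at h1
    have hinj := (ContinuousLinearMap.isUnit_iff_bijective.1 (hAu t ⟨ht.1.1, ht.1.2.le⟩)).1
    have h2 : x' t = 0 := hinj (by rw [h1, map_zero])
    have := hx' t ht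
    rwa [h2] at this
  intro t ht
  rcases ht.1.eq_or_lt with rfl | hat
  · exact hua
  have hc := integral_eq_of_hasDerivAt_off_countable_of_le x (fun _ => 0) ht.2 hS.countable
    (hxc.mono (fun s hs => ⟨hat.trans_le hs.1, hs.2⟩))
    (fun s hs => hx0 s ⟨⟨hat.trans hs.1.1, hs.1.2⟩, hs.2⟩) (by simp)
  have hxb : x b = 0 := by simp [x, hwb]
  have hxt : x t = 0 := by simpa [hxb] using hc
  have := hAx t ⟨hat, ht.2⟩
  rw [hxt, map_zero] at this
  exact sub_eq_zero.1 this.symm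

/-- **(Hermann, Lemma 31.9.)** Suppose `[a,b] ⊆ [0,τ]` contains no pair of mutually
conjugate points, `u` is continuous piecewise `C²`, `v` is a `C²` solution of
`v'' + R_t v = 0` on `[a,b]`, and `u(a) = v(a)`, `u(b) = v(b)`.  Then
`∫_a^b (⟪v',v'⟫ - ⟪R_t v, v⟫) ≤ ∫_a^b (⟪u',u'⟫ - ⟪R_t u, u⟫)`,
with equality only if `u = v` on `[a,b]`. -/
theorem jacobi_field_minimizes
    {E : Type*} [NormedAddCommGroup E] [InnerProductSpace ℝ E] [FiniteDimensional ℝ E]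
    (τ : ℝ) (hτ : 0 < τ)
    (R : ℝ → E →L[ℝ] E) (hRcont : ContinuousOn R (Set.Icc 0 τ))
    (hRsa : ∀ t ∈ Set.Icc (0:ℝ) τ, ∀ u v : E, ⟪R t u, v⟫ = ⟪u, R t v⟫)
    (a b : ℝ) (ha : 0 ≤ a) (hab : a < b) (hb : b ≤ τ)
    (hconj : ∀ c ∈ Set.Icc a b, ∀ d ∈ Set.Icc a b, ¬ MutuallyConjugate R c d)
    (u v : ℝ → E)
    (hu : PiecewiseContDiffOn 2 u a b)
    (hv : ContDiffOn ℝ 2 v (Set.Icc a b))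
    (hvode : ∀ t ∈ Set.Icc a b,
      derivWithin (derivWithin v (Set.Icc a b)) (Set.Icc a b) t + R t (v t) = 0)
    (hua : u a = v a) (hub : u b = v b) :
    (∫ t in a..b, (⟪derivWithin v (Set.Icc a b) t, derivWithin v (Set.Icc a b) t⟫
        - ⟪R t (v t), v t⟫)) ≤
      (∫ t in a..b, (⟪derivWithin u (Set.Icc a b) t, derivWithin u (Set.Icc a b) t⟫
        - ⟪R t (u t), u t⟫)) ∧
    ((∫ t in a..b, (⟪derivWithin v (Set.Icc a b) t, derivWithin v (Set.Icc a b) t⟫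
        - ⟪R t (v t), v t⟫)) =
      (∫ t in a..b, (⟪derivWithin u (Set.Icc a b) t, derivWithin u (Set.Icc a b) t⟫
        - ⟪R t (u t), u t⟫)) →
      ∀ t ∈ Set.Icc a b, u t = v t) := by
  have hsub : Set.Icc a b ⊆ Set.Icc 0 τ := Set.Icc_subset_Icc ha hb
  obtain ⟨S, hS, h1, h2, ξ, h3⟩ := aux_piecewise u a b hab hu
  have hU := uniqueDiffOn_Icc hab
  have hv1 : ContDiffOn ℝ 1 (derivWithin v (Set.Icc a b)) (Set.Icc a b) :=
    hv.derivWithin hU (by norm_num)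
  refine aux_main R a b hab (hRcont.mono hsub) (fun t ht => hRsa t (hsub ht)) hconj u v
    (derivWithin u (Set.Icc a b)) (derivWithin v (Set.Icc a b)) S hS hu.1 ?_ ?_ h2 ξ h3 ?_ ?_
    hua hub
  · intro t ht
    have hn : Set.Icc a b ∈ nhds t := Icc_mem_nhds ht.1.1 ht.1.2
    rw [derivWithin_of_mem_nhds hn]
    exact ((h1 t ht).differentiableAt (by norm_num)).hasDerivAt
  · intro t ht
    have hc : ContinuousAt (deriv u) t := by
      have : ContDiffAt ℝ 1 (deriv u) t := (h1 t ht).derivWithin (by norm_num)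
      exact this.continuousAt
    refine hc.congr ?_
    filter_upwards [Ioo_mem_nhds ht.1.1 ht.1.2] with s hs
    exact (derivWithin_of_mem_nhds (Icc_mem_nhds hs.1 hs.2)).symm
  · intro t ht
    exact (hv.differentiableOn (by norm_num) t ht).hasDerivWithinAt
  · intro t ht
    rw [← eq_neg_of_add_eq_zero_left (hvode t ht)]
    exact (hv1.differentiableOn (by norm_num) t ht).hasDerivWithinAt
end
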